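/- arXiv:2307.14573 — 3 statements merged into one kernel-verified Lean document; each statement's English description precedes it below -/
import Mathlib

section
/- Let A be a unital associative ℂ-algebra, X an n×n symmetric matrix over A whose entries pairwise commute, Y an n×m matrix over A, and H an n×m matrix over A such that [X_{ij}, Y_{kl}] = −(δ_{ik} H_{jl} + δ_{jk} H_{il}) for all i,j,k,l, and every entry of X commutes with every entry of H (automatic when n ≥ 4). Then for any subsets I = {i_1 < ⋯ < i_r} ⊆ [n] and L = {l_1 < ⋯ < l_r} ⊆ [m], cdet(M) = Σ_{J ⊆ [n], |J| = r} cdet(X_{IJ}) · cdet(Y_{JL}), where M is the r×r matrix with (a,b)-entry (XY)_{i_a, l_b} + (r−b) H_{i_a, l_b}, and for J = {j_1 < ⋯ < j_r}, X_{IJ} has (a,b)-entry X_{i_a, j_b} and Y_{JL} has (a,b)-entry Y_{j_a, l_b}. -/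
/-!
STATEMENT 5: generalized Turnbull identity for column determinants of symmetric matrices:
cdet((XY)_{IL} + H_{IL}·diag(r−1,…,0)) = Σ_{J⊆[n], |J|=r} cdet(X_{IJ})·cdet(Y_{JL}).
-/

namespace Stmt5

open Matrix

/-- The column determinant `cdet(M) = Σ_σ sgn(σ) M_{σ(1),1} M_{σ(2),2} ⋯ M_{σ(r),r}`
of a square matrix over a possibly noncommutative ring, with the product taken
in the displayed order. -/
def cdet {A : Type*} [Ring A] {r : ℕ} (M : Matrix (Fin r) (Fin r) A) : A :=
  ∑ σ : Equiv.Perm (Fin r),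
    (Equiv.Perm.sign σ : ℤ) • ((List.finRange r).map (fun t => M (σ t) t)).prod

theorem add_nsmul_mul_prod_ofFn {R ι : Type*} [Ring R] (χ : ι → R) (ξ θ : R)
    (hξ : ∀ j, ξ * χ j = -(χ j * ξ) + χ j * θ) (hθ : ∀ j, θ * χ j = -(χ j * θ))
    (k c : ℕ) (f : Fin k → ι) :
    (ξ + (c + k) • θ) * (List.ofFn fun b => χ (f b)).prod
      = (-1) ^ k * (List.ofFn fun b => χ (f b)).prod * (ξ + c • θ) := by
  induction k with
  | zero => simp
  | succ k ih =>
    have h : (ξ + (c + (k + 1)) • θ) * χ (f 0) = -χ (f 0) * (ξ + (c + k) • θ) := by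
      simp only [add_mul, mul_add, smul_mul_assoc, mul_smul_comm, hξ, hθ, add_smul, one_smul,
        smul_neg, neg_mul]
      abel
    rw [List.ofFn_succ, List.prod_cons, ← mul_assoc, h, mul_assoc, ih (fun b => f b.succ),
      pow_succ']
    have hc : ((-1 : R) ^ k) * χ (f 0) = χ (f 0) * (-1) ^ k :=
      ((Commute.neg_one_left _).pow_left k).eq
    simp only [← mul_assoc, neg_mul, one_mul, hc]

theorem mul_prod_ofFn_of_anticomm {R ι : Type*} [Ring R] (χ : ι → R)
    (hχ : ∀ j k, χ j * χ k = -(χ k * χ j)) (k : ℕ) (f : Fin k → ι) (j : ι) :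
    χ j * (List.ofFn fun b => χ (f b)).prod
      = (-1) ^ k * (List.ofFn fun b => χ (f b)).prod * χ j := by
  simpa using add_nsmul_mul_prod_ofFn χ (χ j) 0 (fun i => by simp [hχ j i]) (by simp) k 0 f

/-- Normal ordering of a product of corrected factors `ξ l = ∑ j, χ j * y j l`. -/
theorem prod_ofFn_add_nsmul_eq_sum {R ι κ : Type*} [Ring R] [Fintype ι] (χ : ι → R)
    (y : ι → κ → R) (θ : κ → R) (hχ : ∀ j k, χ j * χ k = -(χ k * χ j))
    (hξ : ∀ l j, (∑ k, χ k * y k l) * χ j = -(χ j * ∑ k, χ k * y k l) + χ j * θ l)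
    (hθ : ∀ l j, θ l * χ j = -(χ j * θ l)) (r : ℕ) (l : Fin r → κ) :
    (List.ofFn fun b : Fin r => (∑ k, χ k * y k (l b)) + (r - 1 - (b : ℕ)) • θ (l b)).prod
      = ∑ f : Fin r → ι, (List.ofFn fun b => χ (f b)).prod *
          (List.ofFn fun b => y (f b) (l b)).prod := by
  induction r with
  | zero => simp
  | succ r ih =>
    have hr : ∀ b : Fin r, r + 1 - 1 - ((b.succ : Fin (r + 1)) : ℕ) = r - 1 - (b : ℕ) := by
      intro b; simp only [Fin.val_succ]; omega
    rw [List.ofFn_succ, List.prod_cons]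
    simp only [hr]
    rw [ih (fun b => l b.succ), ← (Fin.consEquiv fun _ => ι).sum_comp, Fintype.sum_prod_type_right,
      Finset.mul_sum]
    refine Finset.sum_congr rfl fun g _ => ?_
    have h := add_nsmul_mul_prod_ofFn χ _ (θ (l 0)) (hξ (l 0)) (hθ (l 0)) r 0 g
    simp only [zero_add, zero_smul, add_zero] at h
    rw [← mul_assoc]
    simp only [Fin.val_zero, Nat.add_sub_cancel, Nat.sub_zero]
    rw [h, Finset.mul_sum, Finset.sum_mul]
    refine Finset.sum_congr rfl fun j _ => ?_
    simp only [Fin.consEquiv_apply, List.ofFn_succ, Fin.cons_zero, Fin.cons_succ, List.prod_cons]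
    rw [mul_prod_ofFn_of_anticomm χ hχ]
    simp only [mul_assoc]

universe u

theorem exists_commRing_lift {A : Type u} {ι κ : Type*} [Ring A] (X : ι → κ → A)
    (hX : ∀ i j k l, Commute (X i j) (X k l)) :
    ∃ (S : Type u) (_ : CommRing S) (φ : S →+* A) (Z : ι → κ → S),
      ∀ i j, φ (Z i j) = X i j := by
  let s : Set A := {a | ∃ i j, X i j = a}
  have hs : ∀ x ∈ s, ∀ y ∈ s, x * y = y * x := by
    rintro _ ⟨i, j, rfl⟩ _ ⟨k, l, rfl⟩
    exact hX i j k l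
  exact ⟨Subring.closure s, { (Subring.closure s).toRing with
      mul_comm := (Subring.isMulCommutative_closure hs).is_comm.comm }, (Subring.closure s).subtype,
    fun i j => ⟨X i j, Subring.subset_closure ⟨i, j, rfl⟩⟩, fun _ _ => rfl⟩

theorem cdet_map {A S : Type*} [Ring A] [CommRing S] (φ : S →+* A) {r : ℕ}
    (Z : Matrix (Fin r) (Fin r) S) : cdet (Matrix.of fun a b => φ (Z a b)) = φ Z.det := by
  simp only [cdet, Matrix.det_apply, map_sum, Matrix.of_apply]
  refine Finset.sum_congr rfl fun σ _ => ?_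
  rw [Units.smul_def, map_zsmul, Fin.prod_univ_def, map_list_prod, List.map_map]
  rfl

theorem cdet_comp_perm {A ι κ : Type*} [Ring A] (X : ι → κ → A)
    (hX : ∀ i j k l, Commute (X i j) (X k l)) {r : ℕ} (I : Fin r → ι) (f : Fin r → κ)
    (σ : Equiv.Perm (Fin r)) :
    cdet (Matrix.of fun a b => X (I a) (f (σ b)))
      = (Equiv.Perm.sign σ : ℤ) • cdet (Matrix.of fun a b => X (I a) (f b)) := by
  obtain ⟨S, _, φ, Z, hZ⟩ := exists_commRing_lift X hX
  simp only [← hZ]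
  have hdet := fun g : Fin r → κ => cdet_map φ (Matrix.of fun a b => Z (I a) (g b))
  simp only [Matrix.of_apply] at hdet
  rw [hdet fun b => f (σ b), hdet f,
    ← map_zsmul, zsmul_eq_mul]
  exact congrArg φ (Matrix.det_permute' σ (Matrix.of fun a b => Z (I a) (f b)))

theorem cdet_eq_zero_of_not_injective {A ι κ : Type*} [Ring A] (X : ι → κ → A)
    (hX : ∀ i j k l, Commute (X i j) (X k l)) {r : ℕ} (I : Fin r → ι) (f : Fin r → κ)
    (hf : ¬ Function.Injective f) : cdet (Matrix.of fun a b => X (I a) (f b)) = 0 := by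
  obtain ⟨S, _, φ, Z, hZ⟩ := exists_commRing_lift X hX
  obtain ⟨b, c, hbc, hne⟩ := Function.not_injective_iff.mp hf
  simp only [← hZ]
  have hdet := fun g : Fin r → κ => cdet_map φ (Matrix.of fun a b => Z (I a) (g b))
  simp only [Matrix.of_apply] at hdet
  rw [hdet f,
    Matrix.det_zero_of_column_eq hne fun a => by simp only [Matrix.of_apply, hbc], map_zero]

/-- Cauchy–Binet: a sum over all column tuples collapses to a sum over increasing ones. -/
theorem sum_cdet_mul_prod_ofFn {A ι : Type*} [Ring A] {n r m : ℕ} (X : ι → Fin n → A)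
    (hX : ∀ i j k l, Commute (X i j) (X k l)) (Y : Fin n → Fin m → A) (I : Fin r → ι)
    (L : Fin r → Fin m) :
    ∑ f : Fin r → Fin n, cdet (Matrix.of fun a b => X (I a) (f b)) *
        (List.ofFn fun b => Y (f b) (L b)).prod
      = ∑ J : {J : Finset (Fin n) // J.card = r},
          cdet (Matrix.of fun a b : Fin r => X (I a) (J.1.orderEmbOfFin J.2 b)) *
          cdet (Matrix.of fun a b : Fin r => Y (J.1.orderEmbOfFin J.2 a) (L b)) := by
  let e : {J : Finset (Fin n) // J.card = r} × Equiv.Perm (Fin r) → (Fin r → Fin n) :=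
    fun p b => p.1.1.orderEmbOfFin p.1.2 (p.2 b)
  have he : Function.Injective e := by
    rintro ⟨⟨J, hJ⟩, σ⟩ ⟨⟨K, hK⟩, τ⟩ h
    have hrange : ∀ p, Set.range (e p) = (p.1.1 : Set (Fin n)) := fun p => by
      rw [← Finset.range_orderEmbOfFin p.1.1 p.1.2]
      exact p.2.surjective.range_comp _
    obtain rfl : J = K := Finset.coe_injective <| by
      rw [← hrange ⟨⟨J, hJ⟩, σ⟩, h, hrange]
    obtain rfl : σ = τ := Equiv.ext fun b =>
      (J.orderEmbOfFin hJ).injective (congrFun h b)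
    rfl
  have hrange : ∀ f ∉ Set.range e, ¬ Function.Injective f := by
    intro f hf hinj
    let J : Finset (Fin n) := Finset.univ.image f
    have hJ : J.card = r := by
      rw [Finset.card_image_of_injective _ hinj, Finset.card_univ, Fintype.card_fin]
    have hmem : ∀ b, ∃ c, J.orderEmbOfFin hJ c = f b := fun b => by
      have : f b ∈ Set.range (J.orderEmbOfFin hJ) := by
        rw [Finset.range_orderEmbOfFin]
        exact Finset.mem_coe.mpr (Finset.mem_image_of_mem f (Finset.mem_univ b))
      exact this
    choose g hg using hmem
    have hg_inj : Function.Injective g := fun b c hbc => hinj (by rw [← hg, ← hg, hbc])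
    exact hf ⟨(⟨J, hJ⟩, Equiv.ofBijective g (Finite.injective_iff_bijective.mp hg_inj)),
      funext hg⟩
  rw [← Fintype.sum_of_injective e he _ _
    (fun f hf => by rw [cdet_eq_zero_of_not_injective X hX I f (hrange f hf), zero_mul])
    fun _ => rfl, Fintype.sum_prod_type]
  refine Finset.sum_congr rfl fun J _ => ?_
  simp only [e]
  conv_rhs => rw [cdet.eq_def (Matrix.of fun a b : Fin r => Y _ _), Finset.mul_sum]
  refine Finset.sum_congr rfl fun σ _ => ?_
  rw [cdet_comp_perm X hX, List.ofFn_eq_map, smul_mul_assoc, mul_smul_comm]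
  rfl

open scoped TensorProduct

/-- The coefficient of `ψ_{I 0} ⋯ ψ_{I (r-1)}` in an element of the exterior algebra on `ψ_i`
with coefficients in `A`. -/
noncomputable def grassmannCoeff (R : Type*) [CommRing R] {ι : Type*} {A : Type*} [Ring A]
    [Algebra R A] {r : ℕ} (I : Fin r → ι) : A ⊗[R] ExteriorAlgebra R (ι → R) →ₗ[R] A :=
  (TensorProduct.rid R A).toLinearMap ∘ₗ
    (ExteriorAlgebra.liftAlternating (R := R) (M := ι → R) (N := R) (Pi.single r
      (Matrix.detRowAlternating.compLinearMap (LinearMap.funLeft R R I)))).lTensor A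

section
variable {R : Type*} [CommRing R] {ι : Type*} {A : Type*} [Ring A] [Algebra R A]

theorem grassmannCoeff_mul_tmul_one {r : ℕ} (I : Fin r → ι)
    (w : A ⊗[R] ExteriorAlgebra R (ι → R)) (a : A) :
    grassmannCoeff R I (w * (a ⊗ₜ 1)) = grassmannCoeff R I w * a := by
  induction w with
  | zero => simp
  | add x y hx hy => simp [add_mul, hx, hy]
  | tmul x y => simp [grassmannCoeff]

theorem prod_ofFn_tmul {B : Type*} [Ring B] [Algebra R B] {r : ℕ} (a : Fin r → A)
    (b : Fin r → B) :
    (List.ofFn fun t => a t ⊗ₜ[R] b t).prod = (List.ofFn a).prod ⊗ₜ (List.ofFn b).prod := by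
  induction r with
  | zero => simp [Algebra.TensorProduct.one_def]
  | succ r ih => simp [List.ofFn_succ, ih]

variable [Fintype ι] [DecidableEq ι]

variable (R) in
/-- The Grassmann one-form `∑ i, v i ψ_i`. -/
noncomputable def oneForm (v : ι → A) : A ⊗[R] ExteriorAlgebra R (ι → R) :=
  ∑ i, v i ⊗ₜ ExteriorAlgebra.ι R (Pi.single i (1 : R))

theorem grassmannCoeff_prod_oneForm {r : ℕ} (I : Fin r → ι) (M : ι → Fin r → A) :
    grassmannCoeff R I (List.ofFn fun t => oneForm R fun i => M i t).prod
      = cdet (Matrix.of fun a t => M (I a) t) := by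
  have h := (MultilinearMap.mkPiAlgebraFin R r (A ⊗[R] ExteriorAlgebra R (ι → R))).map_sum
    (fun (t : Fin r) (i : ι) => M i t ⊗ₜ ExteriorAlgebra.ι R (Pi.single i (1 : R)))
  simp only [MultilinearMap.mkPiAlgebraFin_apply] at h
  simp only [oneForm]
  rw [h, map_sum]
  have key : ∀ f : Fin r → ι, grassmannCoeff R I (List.ofFn fun t =>
      M (f t) t ⊗ₜ[R] ExteriorAlgebra.ι R (Pi.single (f t) (1 : R))).prod
      = ∑ σ : Equiv.Perm (Fin r), if (fun t => I (σ t)) = f then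
          (Equiv.Perm.sign σ : ℤ) • (List.ofFn fun t => M (f t) t).prod else 0 := by
    intro f
    rw [prod_ofFn_tmul, ← ExteriorAlgebra.ιMulti_apply]
    simp only [grassmannCoeff, LinearMap.comp_apply, LinearMap.lTensor_tmul,
      ExteriorAlgebra.liftAlternating_apply_ιMulti, Pi.single_eq_same, LinearEquiv.coe_coe,
      TensorProduct.rid_tmul, AlternatingMap.compLinearMap_apply]
    rw [← AlternatingMap.coe_multilinearMap]
    change (Matrix.det (Matrix.of fun t a => (Pi.single (f t) (1 : R) : ι → R) (I a))) • _ = _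
    rw [← Matrix.det_transpose, Matrix.det_apply, Finset.sum_smul]
    refine Finset.sum_congr rfl fun σ _ => ?_
    simp only [Matrix.transpose_apply, Matrix.of_apply, Pi.single_apply]
    rw [Finset.prod_ite_zero]
    simp [funext_iff, Units.smul_def, Int.cast_smul_eq_zsmul]
  simp only [key]
  rw [Finset.sum_comm]
  simp only [Finset.sum_ite_eq, Finset.mem_univ, if_true, cdet, List.ofFn_eq_map, Matrix.of_apply]

theorem oneForm_mul_oneForm (u v : ι → A) :
    oneForm R u * oneForm R v = ∑ i, ∑ j, (u i * v j) ⊗ₜ[R]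
      (ExteriorAlgebra.ι R (Pi.single i (1 : R)) * ExteriorAlgebra.ι R (Pi.single j (1 : R))) := by
  simp [oneForm, Finset.sum_mul_sum]

theorem oneForm_anticomm (u v : ι → A) (h : ∀ i j, Commute (u i) (v j)) :
    oneForm R u * oneForm R v = -(oneForm R v * oneForm R u) := by
  rw [oneForm_mul_oneForm, oneForm_mul_oneForm, Finset.sum_comm, ← Finset.sum_neg_distrib]
  refine Finset.sum_congr rfl fun j _ => ?_
  rw [← Finset.sum_neg_distrib]
  refine Finset.sum_congr rfl fun i _ => ?_
  rw [(h i j).eq, ← TensorProduct.tmul_neg]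
  exact congrArg _ (eq_neg_of_add_eq_zero_left (ExteriorAlgebra.ι_add_mul_swap _ _))

theorem sum_symm_tmul_ι_mul_ι (S : ι → ι → A) (hS : ∀ i j, S i j = S j i) :
    ∑ i, ∑ j, S i j ⊗ₜ[R] (ExteriorAlgebra.ι R (Pi.single i (1 : R)) *
      ExteriorAlgebra.ι R (Pi.single j (1 : R) : ι → R)) = 0 := by
  rw [← Fintype.sum_prod_type' (f := fun i j : ι => S i j ⊗ₜ[R]
    (ExteriorAlgebra.ι R (Pi.single i (1 : R) : ι → R) * ExteriorAlgebra.ι R (Pi.single j (1 : R) : ι → R)))]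
  refine Finset.sum_involution (fun p _ => p.swap) (fun p _ => ?_) (fun p _ hp hswap => hp ?_)
    (fun _ _ => Finset.mem_univ _) (fun _ _ => Prod.swap_swap _)
  · rw [Prod.fst_swap, Prod.snd_swap, hS p.2, ← TensorProduct.tmul_add,
      ExteriorAlgebra.ι_add_mul_swap, TensorProduct.tmul_zero]
  · have h : p.2 = p.1 := congrArg Prod.fst hswap
    rw [h, ExteriorAlgebra.ι_sq_zero, TensorProduct.tmul_zero]

theorem oneForm_mul_tmul_one (v : ι → A) (a : A) :
    oneForm R v * (a ⊗ₜ 1) = oneForm R fun i => v i * a := by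
  simp [oneForm, Finset.sum_mul]

theorem oneForm_sum {κ : Type*} (s : Finset κ) (v : κ → ι → A) :
    ∑ k ∈ s, oneForm R (v k) = oneForm R fun i => ∑ k ∈ s, v k i := by
  simp only [oneForm, TensorProduct.sum_tmul]
  exact Finset.sum_comm

theorem oneForm_add (u v : ι → A) :
    oneForm R u + oneForm R v = oneForm R fun i => u i + v i := by
  simp [oneForm, TensorProduct.add_tmul, Finset.sum_add_distrib]

theorem nsmul_oneForm (c : ℕ) (v : ι → A) :
    c • oneForm R v = oneForm R fun i => c • v i := by
  simp only [oneForm, Finset.smul_sum, TensorProduct.smul_tmul']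

theorem oneForm_mul_swap {u x w : ι → A} {S : ι → ι → A} (hS : ∀ i j, S i j = S j i)
    (h : ∀ i k, u i * x k = x k * u i + S i k + x i * w k) :
    oneForm R u * oneForm R x = -(oneForm R x * oneForm R u) + oneForm R x * oneForm R w := by
  have hswap : -(oneForm R x * oneForm R u) = ∑ i, ∑ k, (x k * u i) ⊗ₜ[R]
      (ExteriorAlgebra.ι R (Pi.single i (1 : R)) *
        ExteriorAlgebra.ι R (Pi.single k (1 : R))) := by
    rw [oneForm_mul_oneForm, Finset.sum_comm, ← Finset.sum_neg_distrib]
    refine Finset.sum_congr rfl fun i _ => ?_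
    rw [← Finset.sum_neg_distrib]
    refine Finset.sum_congr rfl fun k _ => ?_
    rw [← TensorProduct.tmul_neg]
    exact congrArg _ (neg_eq_of_add_eq_zero_left (ExteriorAlgebra.ι_add_mul_swap _ _))
  rw [hswap, oneForm_mul_oneForm, oneForm_mul_oneForm]
  simp only [h, TensorProduct.add_tmul, Finset.sum_add_distrib]
  rw [sum_symm_tmul_ι_mul_ι S hS, add_zero]

end

theorem turnbull_symmetric_cdet
    {A : Type*} [Ring A] [Algebra ℂ A] (n m r : ℕ)
    (X : Matrix (Fin n) (Fin n) A) (Y H : Matrix (Fin n) (Fin m) A)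
    (hXsymm : ∀ i j, X i j = X j i)
    (hXcomm : ∀ i j k l, Commute (X i j) (X k l))
    (hXY : ∀ i j k l, X i j * Y k l - Y k l * X i j
        = -((if i = k then H j l else 0) + (if j = k then H i l else 0)))
    (hXH : ∀ i j k l, Commute (X i j) (H k l))
    (I : Fin r → Fin n) (hI : StrictMono I) (L : Fin r → Fin m) (hL : StrictMono L) :
    cdet (Matrix.of fun a b : Fin r =>
        (X * Y) (I a) (L b) + (r - 1 - (b : ℕ)) • H (I a) (L b))
      = ∑ J : {J : Finset (Fin n) // J.card = r},
          cdet (Matrix.of fun a b : Fin r => X (I a) (J.1.orderEmbOfFin J.2 b)) *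
          cdet (Matrix.of fun a b : Fin r => Y (J.1.orderEmbOfFin J.2 a) (L b)) := by
  let χ : Fin n → A ⊗[ℂ] ExteriorAlgebra ℂ (Fin n → ℂ) := fun j => oneForm ℂ fun i => X i j
  let y : Fin n → Fin m → A ⊗[ℂ] ExteriorAlgebra ℂ (Fin n → ℂ) := fun j l => Y j l ⊗ₜ 1
  let θ : Fin m → A ⊗[ℂ] ExteriorAlgebra ℂ (Fin n → ℂ) := fun l => oneForm ℂ fun i => H i l
  have hξ : ∀ l, ∑ k, χ k * y k l = oneForm ℂ fun i => (X * Y) i l := fun l => by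
    simp only [χ, y, oneForm_mul_tmul_one, oneForm_sum, Matrix.mul_apply]
  have hYX : ∀ p l k j, Y p l * X k j
      = X k j * Y p l + ((if k = p then H j l else 0) + (if j = p then H k l else 0)) :=
    fun p l k j => by
      have h := hXY k j p l
      rw [← neg_inj, neg_neg, neg_sub] at h
      rw [← h]; abel
  have hcomm : ∀ l j i k, (X * Y) i l * X k j
      = X k j * (X * Y) i l + X i k * H j l + X i j * H k l := fun l j i k => by
    simp only [Matrix.mul_apply, Finset.sum_mul, Finset.mul_sum, mul_assoc, hYX, mul_add,
      Finset.sum_add_distrib, mul_ite, mul_zero, Finset.sum_ite_eq, Finset.mem_univ, if_true,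
      add_assoc]
    refine congrArg (· + _) (Finset.sum_congr rfl fun p _ => ?_)
    rw [← mul_assoc, ← mul_assoc, (hXcomm i p k j).eq]
  have key := prod_ofFn_add_nsmul_eq_sum χ y θ
    (fun j k => oneForm_anticomm _ _ fun a b => hXcomm _ _ _ _)
    (fun l j => by
      rw [hξ]
      exact oneForm_mul_swap (S := fun i k => X i k * H j l) (fun i k => by rw [hXsymm])
        (hcomm l j))
    (fun l j => oneForm_anticomm _ _ fun a b => (hXH _ _ _ _).symm) r L
  have hy : ∀ f : Fin r → Fin n, (List.ofFn fun b => y (f b) (L b)).prod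
      = (List.ofFn fun b => Y (f b) (L b)).prod ⊗ₜ 1 := fun f => by
    simp only [y, prod_ofFn_tmul]
    simp
  have hcoeff := congrArg (grassmannCoeff ℂ I) key
  simp only [hξ, θ, nsmul_oneForm, oneForm_add, hy, map_sum, grassmannCoeff_mul_tmul_one] at hcoeff
  rw [grassmannCoeff_prod_oneForm I fun i b => (X * Y) i (L b) + (r - 1 - (b : ℕ)) • H i (L b)]
    at hcoeff
  rw [hcoeff, ← sum_cdet_mul_prod_ofFn X hXcomm Y I L]
  refine Finset.sum_congr rfl fun f _ => ?_
  rw [grassmannCoeff_prod_oneForm I fun i b => X i (f b)]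

end Stmt5
end

section
/- Let n be an even positive integer, A a unital associative ℂ-algebra, X an n×n matrix over A whose entries pairwise commute, Y an n×n antisymmetric matrix over A whose entries pairwise commute, and h ∈ A an element commuting with every entry of X and of Y, such that [X_{ij}, Y_{kl}] = −h(δ_{jk}δ_{il} − δ_{ik}δ_{jl}) for all 1 ≤ i,j,k,l ≤ n. Then cdet(XY + h·D) = cdet(X) · cdet(Y), where D = diag(n−2, n−3, …, 1, 0, −1), i.e. the matrix inside the left-hand column determinant has (a,b)-entry Σ_j X_{aj}Y_{jb} + δ_{ab}·d_b·h with (d_1,…,d_n) = (n−2, n−3, …, 0, −1). -/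
/-!
STATEMENT 8: generalized Howe–Umeda–Kostant–Sahi identity, even case:
cdet(XY + h·diag(n−2, n−3, …, 0, −1)) = cdet(X)·cdet(Y).
-/

namespace Stmt8

open Matrix

/-- The column determinant `cdet(M) = Σ_σ sgn(σ) M_{σ(1),1} ⋯ M_{σ(n),n}` of a square
matrix over a possibly noncommutative ring, product taken in the displayed order. -/
def cdet {A : Type*} [Ring A] {n : ℕ} (M : Matrix (Fin n) (Fin n) A) : A :=
  ∑ σ : Equiv.Perm (Fin n),
    (Equiv.Perm.sign σ : ℤ) • ((List.finRange n).map (fun t => M (σ t) t)).prod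

/-! ### Column determinants -/

theorem map_cdet {A B : Type*} [Ring A] [Ring B] {n : ℕ} (f : A →+* B)
    (M : Matrix (Fin n) (Fin n) A) : f (cdet M) = cdet (M.map f) := by
  simp [cdet, map_sum, map_list_prod, Function.comp_def]

theorem cdet_eq_det {A : Type*} [CommRing A] {n : ℕ} (M : Matrix (Fin n) (Fin n) A) :
    cdet M = M.det := by
  simp [cdet, det_apply, Fin.prod_univ_def, Units.smul_def]

theorem cdet_mul_of_commute {A : Type*} [Ring A] {n : ℕ} {M N : Matrix (Fin n) (Fin n) A}
    (hM : ∀ i j k l, Commute (M i j) (M k l)) (hN : ∀ i j k l, Commute (N i j) (N k l))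
    (hMN : ∀ i j k l, Commute (M i j) (N k l)) : cdet (M * N) = cdet M * cdet N := by
  set s : Set A := Set.range (fun p : Fin n × Fin n => M p.1 p.2) ∪
    Set.range (fun p : Fin n × Fin n => N p.1 p.2) with hs
  have hcomm : ∀ a ∈ s, ∀ b ∈ s, a * b = b * a := by
    rintro _ (⟨p, rfl⟩ | ⟨p, rfl⟩) _ (⟨q, rfl⟩ | ⟨q, rfl⟩)
    · exact hM _ _ _ _
    · exact hMN _ _ _ _
    · exact (hMN _ _ _ _).symm
    · exact hN _ _ _ _
  let _ : CommRing (Subring.closure s) :=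
    { (inferInstance : Ring (Subring.closure s)) with
      mul_comm := (Subring.isMulCommutative_closure hcomm).is_comm.comm }
  let M' : Matrix (Fin n) (Fin n) (Subring.closure s) := fun i j =>
    ⟨M i j, Subring.subset_closure (Or.inl ⟨(i, j), rfl⟩)⟩
  let N' : Matrix (Fin n) (Fin n) (Subring.closure s) := fun i j =>
    ⟨N i j, Subring.subset_closure (Or.inr ⟨(i, j), rfl⟩)⟩
  let f : Subring.closure s →+* A := (Subring.closure s).subtype
  have hM' : M = M'.map f := rfl
  have hN' : N = N'.map f := rfl
  rw [hM', hN', ← Matrix.map_mul, ← map_cdet, ← map_cdet, ← map_cdet, ← map_mul]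
  congr 1
  rw [cdet_eq_det, cdet_eq_det, cdet_eq_det, det_mul]

/-! ### Products of sums obeying an exchange relation -/

section Exchange

variable {E : Type*} [Ring E]

theorem list_prod_sum_range_succ (κ : ℕ → ℕ → E)
    (hex : ∀ c e i, κ c i * κ e (i + 1) = κ e i * κ c (i + 1))
    (hsq : ∀ c i, κ c i * κ c (i + 1) = 0) (m k : ℕ) :
    ((List.range (k + 1)).map fun i => ∑ c ∈ Finset.range (m + 1), κ c i).prod =
      ((List.range (k + 1)).map fun i => ∑ c ∈ Finset.range m, κ c i).prod +
        (k + 1) • (((List.range k).map fun i => ∑ c ∈ Finset.range m, κ c i).prod * κ m k) := by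
  induction k with
  | zero => simp [Finset.sum_range_succ]
  | succ k ih =>
    have hswap : κ m k * ∑ c ∈ Finset.range m, κ c (k + 1) =
        (∑ c ∈ Finset.range m, κ c k) * κ m (k + 1) := by
      rw [Finset.mul_sum, Finset.sum_mul]
      exact Finset.sum_congr rfl fun c _ => hex _ _ _
    rw [List.prod_range_succ, ih, List.prod_range_succ _ (k + 1), List.prod_range_succ _ k]
    rw [Finset.sum_range_succ _ m]
    simp only [add_mul, mul_add, smul_mul_assoc, mul_assoc, hswap, hsq, mul_zero, smul_zero,
      add_zero]
    rw [succ_nsmul _ (k + 1)]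
    abel

theorem list_prod_sum_range_eq_zero (κ : ℕ → ℕ → E)
    (hex : ∀ c e i, κ c i * κ e (i + 1) = κ e i * κ c (i + 1))
    (hsq : ∀ c i, κ c i * κ c (i + 1) = 0) (m k : ℕ) (hk : m < k) :
    ((List.range k).map fun i => ∑ c ∈ Finset.range m, κ c i).prod = 0 := by
  induction m generalizing k with
  | zero =>
    obtain ⟨k, rfl⟩ := Nat.exists_eq_succ_of_ne_zero hk.ne'
    simp [List.range_succ]
  | succ m ih =>
    obtain ⟨k, rfl⟩ := Nat.exists_eq_succ_of_ne_zero (Nat.ne_zero_of_lt hk)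
    rw [Nat.succ_eq_add_one, list_prod_sum_range_succ κ hex hsq, ih _ (by omega),
      ih _ (by omega)]
    simp

theorem list_prod_sum_range_self (κ : ℕ → ℕ → E)
    (hex : ∀ c e i, κ c i * κ e (i + 1) = κ e i * κ c (i + 1))
    (hsq : ∀ c i, κ c i * κ c (i + 1) = 0) (m : ℕ) :
    ((List.range m).map fun i => ∑ c ∈ Finset.range m, κ c i).prod =
      m.factorial • ((List.range m).map fun i => κ i i).prod := by
  induction m with
  | zero => simp
  | succ m ih =>
    rw [list_prod_sum_range_succ κ hex hsq, list_prod_sum_range_eq_zero κ hex hsq _ _ (by omega),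
      ih, List.prod_range_succ, zero_add, Nat.factorial_succ, smul_mul_assoc, mul_smul]

theorem list_prod_sum_univ {n : ℕ} (κ : Fin n → ℕ → E)
    (hex : ∀ c e i, κ c i * κ e (i + 1) = κ e i * κ c (i + 1))
    (hsq : ∀ c i, κ c i * κ c (i + 1) = 0) :
    ((List.range n).map fun i => ∑ c, κ c i).prod =
      n.factorial • ((List.finRange n).map fun c => κ c c).prod := by
  have key := list_prod_sum_range_self (fun c i => if hc : c < n then κ ⟨c, hc⟩ i else 0)
    (fun c e i => by split_ifs <;> simp [hex])
    (fun c i => by split_ifs <;> simp [hsq]) n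
  simp only [Finset.sum_range, Fin.is_lt, dite_true] at key
  rw [key, ← List.map_coe_finRange_eq_range, List.map_map]
  simp [Function.comp_def]

end Exchange

/-! ### Fermions with noncommutative coefficients -/

/-- Two families `psi`, `theta` of Grassmann variables and the annihilation operators `del`
conjugate to `theta`, acting together with a ring of coefficients. -/
structure Fermions (C E : Type*) [Ring C] [Ring E] (n : ℕ) where
  coef : C →+* E
  psi : Fin n → E
  theta : Fin n → E
  del : Fin n → E
  coef_psi : ∀ c a, Commute (coef c) (psi a)
  coef_theta : ∀ c a, Commute (coef c) (theta a)
  coef_del : ∀ c a, Commute (coef c) (del a)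
  psi_psi : ∀ a b, psi a * psi b = -(psi b * psi a)
  theta_theta : ∀ a b, theta a * theta b = -(theta b * theta a)
  theta_sq : ∀ a, theta a * theta a = 0
  psi_sq : ∀ a, psi a * psi a = 0
  theta_psi : ∀ a b, theta a * psi b = -(psi b * theta a)
  del_psi : ∀ a b, del a * psi b = -(psi b * del a)
  del_theta : ∀ a b, del a * theta b = (if a = b then 1 else 0) - theta b * del a

theorem commute_mul_of_anticommute {E : Type*} [Ring E] {p q r : E} (hp : p * r = -(r * p))
    (hq : q * r = -(r * q)) : Commute (p * q) r := by
  rw [commute_iff_eq, mul_assoc, hq, mul_neg, ← mul_assoc, hp, neg_mul, neg_neg, mul_assoc]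

theorem commute_mul_mul_of_anticommute {E : Type*} [Ring E] {p q r s : E}
    (hpr : p * r = -(r * p)) (hps : p * s = -(s * p)) (hqr : q * r = -(r * q))
    (hqs : q * s = -(s * q)) : Commute (p * q) (r * s) :=
  (commute_mul_of_anticommute hpr hqr).mul_right (commute_mul_of_anticommute hps hqs)

namespace Fermions

variable {C E : Type*} [Ring C] [Ring E] {n : ℕ} (F : Fermions C E n)

/-- The Grassmann combination of the variables `u` along column `j` of `M`. -/
def lin (u : Fin n → E) (M : Matrix (Fin n) (Fin n) C) (j : Fin n) : E :=
  ∑ a, F.coef (M a j) * u a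

theorem coef_lin {u : Fin n → E} (hu : ∀ c a, Commute (F.coef c) (u a)) {c : C}
    {M : Matrix (Fin n) (Fin n) C} (hM : ∀ i j, Commute c (M i j)) (j : Fin n) :
    Commute (F.coef c) (F.lin u M j) :=
  Commute.sum_right _ _ _ fun a _ => ((hM a j).map F.coef).mul_right (hu c a)

theorem anticommute_lin {u : Fin n → E} {w : E} (hw : ∀ c, Commute (F.coef c) w)
    (huw : ∀ a, w * u a = -(u a * w)) (M : Matrix (Fin n) (Fin n) C) (j : Fin n) :
    w * F.lin u M j = -(F.lin u M j * w) := by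
  rw [lin, Finset.mul_sum, Finset.sum_mul, ← Finset.sum_neg_distrib]
  refine Finset.sum_congr rfl fun a _ => ?_
  rw [← mul_assoc, ← (hw _).eq, mul_assoc, huw, mul_neg, mul_assoc]

theorem lin_anticommute_lin {u v : Fin n → E} (hu : ∀ c a, Commute (F.coef c) (u a))
    (hv : ∀ c a, Commute (F.coef c) (v a)) (huv : ∀ a b, u a * v b = -(v b * u a))
    {M N : Matrix (Fin n) (Fin n) C} (hMN : ∀ i j k l, Commute (M i j) (N k l)) (j k : Fin n) :
    F.lin u M j * F.lin v N k = -(F.lin v N k * F.lin u M j) := by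
  conv_lhs => rw [lin, Finset.sum_mul]
  conv_rhs => rw [lin, lin, Finset.mul_sum, ← Finset.sum_neg_distrib]
  refine Finset.sum_congr rfl fun a _ => ?_
  have h₁ := F.anticommute_lin (fun c => hu c a) (huv a) N k
  have h₂ := F.coef_lin hv (c := M a j) (hMN a j) k
  rw [mul_assoc, h₁, mul_neg, ← mul_assoc, h₂.eq, mul_assoc]
  rfl

end Fermions

/-! ### The operators attached to a noncommuting pair of matrices -/

/-- Coefficients for the Howe–Umeda–Kostant–Sahi setting: `X` and `Y` commute with each other,
while `Z` carries the commutation relation with `X`, so that `Y + Z` is the noncommuting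
partner of `X`. -/
structure CapelliData (C : Type*) [Ring C] (n : ℕ) where
  X : Matrix (Fin n) (Fin n) C
  Y : Matrix (Fin n) (Fin n) C
  Z : Matrix (Fin n) (Fin n) C
  h : C
  X_X : ∀ i j k l, Commute (X i j) (X k l)
  Y_Y : ∀ i j k l, Commute (Y i j) (Y k l)
  X_Y : ∀ i j k l, Commute (X i j) (Y k l)
  Y_Z : ∀ i j k l, Commute (Y i j) (Z k l)
  Z_Z : ∀ i j k l, Commute (Z i j) (Z k l)
  h_X : ∀ i j, Commute h (X i j)
  h_Y : ∀ i j, Commute h (Y i j)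
  h_Z : ∀ i j, Commute h (Z i j)
  Y_anti : ∀ k l, Y k l = -Y l k
  Z_anti : ∀ k l, Z k l = -Z l k
  Z_X : ∀ i j k l, Z k l * X i j = X i j * Z k l +
    ((if j = k ∧ i = l then h else 0) - (if i = k ∧ j = l then h else 0))

namespace Fermions

variable {C E : Type*} [Ring C] [Ring E] {n : ℕ} (F : Fermions C E n) (D : CapelliData C n)

def chi (j : Fin n) : E := F.lin F.psi D.X j

def xi (j : Fin n) : E := F.lin F.theta D.Yᵀ j

def zeta (j : Fin n) : E := F.lin F.theta D.Zᵀ j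

def eta (j : Fin n) : E := F.lin F.psi (D.X * D.Yᵀ) j

def opPhi : E := ∑ j, F.chi D j * F.xi D j

def opDelta : E := ∑ j, F.chi D j * F.zeta D j

def opOmega : E := ∑ j, F.coef D.h * (F.chi D j * F.psi j)

def opTau : E := ∑ j, F.coef D.h * (F.psi j * F.theta j)

def opBeta : E := ∑ j, F.theta j * F.xi D j

def opGamma : E := ∑ j, F.chi D j * F.eta D j

def opShift : E := ∑ j, F.chi D j * F.del j

theorem psi_theta (a b : Fin n) : F.psi a * F.theta b = -(F.theta b * F.psi a) := by
  rw [F.theta_psi, neg_neg]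

theorem X_XYt (D : CapelliData C n) (i j k l : Fin n) :
    Commute (D.X i j) ((D.X * D.Yᵀ) k l) := by
  rw [Matrix.mul_apply]
  exact Commute.sum_right _ _ _ fun _ _ => (D.X_X _ _ _ _).mul_right (D.X_Y _ _ _ _)

theorem Y_XYt (D : CapelliData C n) (i j k l : Fin n) :
    Commute (D.Y i j) ((D.X * D.Yᵀ) k l) := by
  rw [Matrix.mul_apply]
  exact Commute.sum_right _ _ _ fun _ _ => (D.X_Y _ _ _ _).symm.mul_right (D.Y_Y _ _ _ _)

theorem h_XYt (D : CapelliData C n) (k l : Fin n) :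
    Commute D.h ((D.X * D.Yᵀ) k l) := by
  rw [Matrix.mul_apply]
  exact Commute.sum_right _ _ _ fun _ _ => (D.h_X _ _).mul_right (D.h_Y _ _)

theorem coef_h_chi (j) : Commute (F.coef D.h) (F.chi D j) := F.coef_lin F.coef_psi D.h_X j
theorem coef_h_xi (j) : Commute (F.coef D.h) (F.xi D j) :=
  F.coef_lin F.coef_theta (fun _ _ => D.h_Y _ _) j
theorem coef_h_zeta (j) : Commute (F.coef D.h) (F.zeta D j) :=
  F.coef_lin F.coef_theta (fun _ _ => D.h_Z _ _) j
theorem coef_h_eta (j) : Commute (F.coef D.h) (F.eta D j) :=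
  F.coef_lin F.coef_psi (h_XYt D) j
theorem coef_Y_chi (i j k) : Commute (F.coef (D.Y i j)) (F.chi D k) :=
  F.coef_lin F.coef_psi (fun _ _ => (D.X_Y _ _ _ _).symm) k

theorem chi_chi (j k) : F.chi D j * F.chi D k = -(F.chi D k * F.chi D j) :=
  F.lin_anticommute_lin F.coef_psi F.coef_psi F.psi_psi D.X_X j k
theorem chi_eta (j k) : F.chi D j * F.eta D k = -(F.eta D k * F.chi D j) :=
  F.lin_anticommute_lin F.coef_psi F.coef_psi F.psi_psi (X_XYt D) j k
theorem chi_xi (j k) : F.chi D j * F.xi D k = -(F.xi D k * F.chi D j) :=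
  F.lin_anticommute_lin F.coef_psi F.coef_theta F.psi_theta (fun _ _ _ _ => D.X_Y _ _ _ _) j k
theorem eta_xi (j k) : F.eta D j * F.xi D k = -(F.xi D k * F.eta D j) :=
  F.lin_anticommute_lin F.coef_psi F.coef_theta F.psi_theta
    (fun _ _ _ _ => (Y_XYt D _ _ _ _).symm) j k
theorem xi_xi (j k) : F.xi D j * F.xi D k = -(F.xi D k * F.xi D j) :=
  F.lin_anticommute_lin F.coef_theta F.coef_theta F.theta_theta (fun _ _ _ _ => D.Y_Y _ _ _ _) j k
theorem zeta_xi (j k) : F.zeta D j * F.xi D k = -(F.xi D k * F.zeta D j) :=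
  F.lin_anticommute_lin F.coef_theta F.coef_theta F.theta_theta
    (fun _ _ _ _ => (D.Y_Z _ _ _ _).symm) j k
theorem psi_chi (j k) : F.psi j * F.chi D k = -(F.chi D k * F.psi j) :=
  F.anticommute_lin (fun c => F.coef_psi c j) (F.psi_psi j) _ _
theorem psi_eta (j k) : F.psi j * F.eta D k = -(F.eta D k * F.psi j) :=
  F.anticommute_lin (fun c => F.coef_psi c j) (F.psi_psi j) _ _
theorem psi_xi (j k) : F.psi j * F.xi D k = -(F.xi D k * F.psi j) :=
  F.anticommute_lin (fun c => F.coef_psi c j) (F.psi_theta j) _ _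
theorem psi_zeta (j k) : F.psi j * F.zeta D k = -(F.zeta D k * F.psi j) :=
  F.anticommute_lin (fun c => F.coef_psi c j) (F.psi_theta j) _ _
theorem theta_chi (j k) : F.theta j * F.chi D k = -(F.chi D k * F.theta j) :=
  F.anticommute_lin (fun c => F.coef_theta c j) (F.theta_psi j) _ _
theorem theta_eta (j k) : F.theta j * F.eta D k = -(F.eta D k * F.theta j) :=
  F.anticommute_lin (fun c => F.coef_theta c j) (F.theta_psi j) _ _
theorem theta_xi (j k) : F.theta j * F.xi D k = -(F.xi D k * F.theta j) :=
  F.anticommute_lin (fun c => F.coef_theta c j) (F.theta_theta j) _ _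
theorem theta_zeta (j k) : F.theta j * F.zeta D k = -(F.zeta D k * F.theta j) :=
  F.anticommute_lin (fun c => F.coef_theta c j) (F.theta_theta j) _ _
theorem del_chi (j k) : F.del j * F.chi D k = -(F.chi D k * F.del j) :=
  F.anticommute_lin (fun c => F.coef_del c j) (F.del_psi j) _ _
theorem del_eta (j k) : F.del j * F.eta D k = -(F.eta D k * F.del j) :=
  F.anticommute_lin (fun c => F.coef_del c j) (F.del_psi j) _ _

theorem neg_swap {E : Type*} [Ring E] {a b : E} (hab : a * b = -(b * a)) : b * a = -(a * b) := by
  rw [hab, neg_neg]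

theorem commute_h_mul {c p q r s : E} (hc₁ : Commute c p) (hc₂ : Commute c q)
    (hpq : Commute (p * q) (r * s)) : Commute (p * q) (c * (r * s)) :=
  (hc₁.mul_right hc₂).symm.mul_right hpq

theorem Phi_Omega : Commute (F.opPhi D) (F.opOmega D) :=
  Commute.sum_left _ _ _ fun j _ => Commute.sum_right _ _ _ fun k _ =>
    commute_h_mul (F.coef_h_chi D j) (F.coef_h_xi D j) <| commute_mul_mul_of_anticommute
      (F.chi_chi D j k) (neg_swap (F.psi_chi D k j)) (neg_swap (F.chi_xi D k j))
      (neg_swap (F.psi_xi D k j))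

theorem Phi_Tau : Commute (F.opPhi D) (F.opTau D) :=
  Commute.sum_left _ _ _ fun j _ => Commute.sum_right _ _ _ fun k _ =>
    commute_h_mul (F.coef_h_chi D j) (F.coef_h_xi D j) <| commute_mul_mul_of_anticommute
      (neg_swap (F.psi_chi D k j)) (neg_swap (F.theta_chi D k j)) (neg_swap (F.psi_xi D k j))
      (neg_swap (F.theta_xi D k j))

theorem Phi_Beta : Commute (F.opPhi D) (F.opBeta D) :=
  Commute.sum_left _ _ _ fun j _ => Commute.sum_right _ _ _ fun k _ =>
    commute_mul_mul_of_anticommute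
      (neg_swap (F.theta_chi D k j)) (F.chi_xi D j k) (neg_swap (F.theta_xi D k j))
      (F.xi_xi D j k)

theorem Phi_Gamma : Commute (F.opPhi D) (F.opGamma D) :=
  Commute.sum_left _ _ _ fun j _ => Commute.sum_right _ _ _ fun k _ =>
    commute_mul_mul_of_anticommute
      (F.chi_chi D j k) (F.chi_eta D j k) (neg_swap (F.chi_xi D k j)) (neg_swap (F.eta_xi D k j))

theorem Beta_Omega : Commute (F.opBeta D) (F.opOmega D) :=
  Commute.sum_left _ _ _ fun j _ => Commute.sum_right _ _ _ fun k _ =>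
    commute_h_mul (F.coef_theta _ j) (F.coef_h_xi D j) <| commute_mul_mul_of_anticommute
      (F.theta_chi D j k) (F.theta_psi j k) (neg_swap (F.chi_xi D k j))
      (neg_swap (F.psi_xi D k j))

theorem Beta_Tau : Commute (F.opBeta D) (F.opTau D) :=
  Commute.sum_left _ _ _ fun j _ => Commute.sum_right _ _ _ fun k _ =>
    commute_h_mul (F.coef_theta _ j) (F.coef_h_xi D j) <| commute_mul_mul_of_anticommute
      (F.theta_psi j k) (F.theta_theta j k) (neg_swap (F.psi_xi D k j))
      (neg_swap (F.theta_xi D k j))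

theorem Beta_Gamma : Commute (F.opBeta D) (F.opGamma D) :=
  Commute.sum_left _ _ _ fun j _ => Commute.sum_right _ _ _ fun k _ =>
    commute_mul_mul_of_anticommute
      (F.theta_chi D j k) (F.theta_eta D j k) (neg_swap (F.chi_xi D k j))
      (neg_swap (F.eta_xi D k j))

theorem Gamma_Omega : Commute (F.opGamma D) (F.opOmega D) :=
  Commute.sum_left _ _ _ fun j _ => Commute.sum_right _ _ _ fun k _ =>
    commute_h_mul (F.coef_h_chi D j) (F.coef_h_eta D j) <| commute_mul_mul_of_anticommute
      (F.chi_chi D j k) (neg_swap (F.psi_chi D k j)) (neg_swap (F.chi_eta D k j))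
      (neg_swap (F.psi_eta D k j))

theorem Gamma_Tau : Commute (F.opGamma D) (F.opTau D) :=
  Commute.sum_left _ _ _ fun j _ => Commute.sum_right _ _ _ fun k _ =>
    commute_h_mul (F.coef_h_chi D j) (F.coef_h_eta D j) <| commute_mul_mul_of_anticommute
      (neg_swap (F.psi_chi D k j)) (neg_swap (F.theta_chi D k j)) (neg_swap (F.psi_eta D k j))
      (neg_swap (F.theta_eta D k j))

theorem Tau_Omega : Commute (F.opTau D) (F.opOmega D) :=
  Commute.sum_left _ _ _ fun j _ => Commute.sum_right _ _ _ fun k _ =>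
    Commute.mul_left
      ((Commute.refl _).mul_right ((F.coef_h_chi D k).mul_right (F.coef_psi _ k))) <|
    commute_h_mul (F.coef_psi _ j) (F.coef_theta _ j) <| commute_mul_mul_of_anticommute
      (F.psi_chi D j k) (F.psi_psi j k) (F.theta_chi D j k) (F.theta_psi j k)

theorem Delta_Beta : Commute (F.opDelta D) (F.opBeta D) :=
  Commute.sum_left _ _ _ fun j _ => Commute.sum_right _ _ _ fun k _ =>
    commute_mul_mul_of_anticommute
      (neg_swap (F.theta_chi D k j)) (F.chi_xi D j k) (neg_swap (F.theta_zeta D k j))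
      (F.zeta_xi D j k)

theorem Delta_Tau : Commute (F.opDelta D) (F.opTau D) :=
  Commute.sum_left _ _ _ fun j _ => Commute.sum_right _ _ _ fun k _ =>
    commute_h_mul (F.coef_h_chi D j) (F.coef_h_zeta D j) <| commute_mul_mul_of_anticommute
      (neg_swap (F.psi_chi D k j)) (neg_swap (F.theta_chi D k j)) (neg_swap (F.psi_zeta D k j))
      (neg_swap (F.theta_zeta D k j))

theorem coef_h_Delta : Commute (F.coef D.h) (F.opDelta D) :=
  Commute.sum_right _ _ _ fun j _ => (F.coef_h_chi D j).mul_right (F.coef_h_zeta D j)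

theorem coef_h_Shift : Commute (F.coef D.h) (F.opShift D) :=
  Commute.sum_right _ _ _ fun j _ => (F.coef_h_chi D j).mul_right (F.coef_del _ j)

theorem commute_sum_mul {u v : Fin n → E} {w : E} (hu : ∀ j, u j * w = -(w * u j))
    (hv : ∀ j, v j * w = -(w * v j)) : Commute (∑ j, u j * v j) w :=
  Commute.sum_left _ _ _ fun j _ => by
    rw [commute_iff_eq, mul_assoc, hv, mul_neg, ← mul_assoc, hu, neg_mul, neg_neg, mul_assoc]

/-! Commutation of `opShift` with the other operators. -/

theorem Shift_chi (k) : Commute (F.opShift D) (F.chi D k) :=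
  commute_sum_mul (fun j => F.chi_chi D j k) (fun j => F.del_chi D j k)

theorem Shift_eta (k) : Commute (F.opShift D) (F.eta D k) :=
  commute_sum_mul (fun j => F.chi_eta D j k) (fun j => F.del_eta D j k)

theorem Shift_psi (k) : Commute (F.opShift D) (F.psi k) :=
  commute_sum_mul (fun j => neg_swap (F.psi_chi D k j)) (fun j => F.del_psi j k)

theorem Shift_theta (k) :
    F.opShift D * F.theta k = F.theta k * F.opShift D + F.chi D k := by
  have : ∀ j, F.chi D j * F.del j * F.theta k =
      F.theta k * (F.chi D j * F.del j) + if j = k then F.chi D j else 0 := by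
    intro j
    rw [mul_assoc, F.del_theta, mul_sub, ← mul_assoc, ← mul_assoc, neg_swap (F.theta_chi D k j)]
    split_ifs <;> simp [sub_eq_add_neg, add_comm]
  rw [opShift, Finset.sum_mul, Finset.mul_sum, Finset.sum_congr rfl fun j _ => this j,
    Finset.sum_add_distrib]
  simp

theorem eta_eq (k) : F.eta D k = ∑ c, F.coef (D.Y k c) * F.chi D c := by
  simp only [eta, chi, lin, Matrix.mul_apply, map_sum, Finset.sum_mul, Finset.mul_sum]
  rw [Finset.sum_comm]
  refine Finset.sum_congr rfl fun c _ => Finset.sum_congr rfl fun a _ => ?_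
  rw [Matrix.transpose_apply, (D.X_Y a c k c).eq, map_mul, mul_assoc]

theorem Shift_xi (k) : F.opShift D * F.xi D k = F.xi D k * F.opShift D + F.eta D k := by
  have hY : ∀ c, Commute (F.coef (D.Y k c)) (F.opShift D) := fun c =>
    Commute.sum_right _ _ _ fun j _ => (F.coef_Y_chi D k c j).mul_right (F.coef_del _ j)
  rw [F.eta_eq, xi, lin, Finset.mul_sum, Finset.sum_mul, ← Finset.sum_add_distrib]
  refine Finset.sum_congr rfl fun c _ => ?_
  rw [Matrix.transpose_apply, ← mul_assoc, ← (hY c).eq, mul_assoc, F.Shift_theta, mul_add,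
    mul_assoc]

theorem Shift_Omega : Commute (F.opShift D) (F.opOmega D) :=
  Commute.sum_right _ _ _ fun k _ => (F.coef_h_Shift D).symm.mul_right
    ((F.Shift_chi D k).mul_right (F.Shift_psi D k))

theorem Shift_Gamma : Commute (F.opShift D) (F.opGamma D) :=
  Commute.sum_right _ _ _ fun k _ => (F.Shift_chi D k).mul_right (F.Shift_eta D k)

theorem Shift_Phi : F.opShift D * F.opPhi D = F.opPhi D * F.opShift D + F.opGamma D := by
  rw [opPhi, opGamma, Finset.mul_sum, Finset.sum_mul, ← Finset.sum_add_distrib]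
  refine Finset.sum_congr rfl fun k _ => ?_
  rw [← mul_assoc, (F.Shift_chi D k).eq, mul_assoc, F.Shift_xi, mul_add, mul_assoc]

theorem Shift_Tau : F.opShift D * F.opTau D = F.opTau D * F.opShift D - F.opOmega D := by
  rw [opTau, opOmega, Finset.mul_sum, Finset.sum_mul, ← Finset.sum_sub_distrib]
  refine Finset.sum_congr rfl fun k _ => ?_
  rw [← mul_assoc, ← (F.coef_h_Shift D).eq, mul_assoc, ← mul_assoc (F.opShift D),
    (F.Shift_psi D k).eq, mul_assoc, F.Shift_theta, mul_add, mul_add, F.psi_chi, mul_neg,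
    ← sub_eq_add_neg, mul_assoc, mul_assoc]

theorem sum_theta_eta : ∑ k, F.theta k * F.eta D k = F.opPhi D := by
  simp only [F.eta_eq, opPhi, xi, lin, Finset.mul_sum]
  rw [Finset.sum_comm]
  refine Finset.sum_congr rfl fun c _ => Finset.sum_congr rfl fun k _ => ?_
  rw [Matrix.transpose_apply, D.Y_anti, map_neg, neg_mul, mul_neg, ← mul_assoc,
    ← (F.coef_theta _ k).eq, mul_assoc, F.theta_chi, mul_neg, neg_neg, ← mul_assoc,
    (F.coef_Y_chi D c k c).eq, mul_assoc]

theorem Shift_Beta :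
    F.opShift D * F.opBeta D = F.opBeta D * F.opShift D + 2 * F.opPhi D := by
  have : ∀ k, F.opShift D * (F.theta k * F.xi D k) = F.theta k * F.xi D k * F.opShift D +
      (F.theta k * F.eta D k + F.chi D k * F.xi D k) := by
    intro k
    rw [← mul_assoc, F.Shift_theta, add_mul, mul_assoc, F.Shift_xi, mul_add, mul_assoc, add_assoc]
  rw [opBeta, Finset.mul_sum, Finset.sum_mul, Finset.sum_congr rfl fun k _ => this k,
    Finset.sum_add_distrib, Finset.sum_add_distrib, F.sum_theta_eta, two_mul]
  rfl

/-! Commutation of `opDelta` with the other operators. -/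

theorem zeta_chi (j k) : F.zeta D j * F.chi D k = -(F.chi D k * F.zeta D j) -
    (if j = k then F.opTau D else 0) + F.coef D.h * (F.psi j * F.theta k) := by
  have key : ∀ c b, F.coef (D.Z j c) * F.theta c * (F.coef (D.X b k) * F.psi b) =
      -(F.coef (D.X b k) * F.psi b * (F.coef (D.Z j c) * F.theta c)) -
      (if j = k ∧ b = c then F.coef D.h * (F.psi b * F.theta c) else 0) +
      (if b = j ∧ c = k then F.coef D.h * (F.psi b * F.theta c) else 0) := by
    intro c b
    have h₁ : F.coef (D.Z j c) * F.theta c * (F.coef (D.X b k) * F.psi b) =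
        -(F.coef (D.Z j c * D.X b k) * (F.psi b * F.theta c)) := by
      rw [(F.coef_theta _ c).eq, mul_assoc, ← mul_assoc (F.coef _), ← map_mul, ← mul_assoc,
        ← (F.coef_theta _ c).eq, mul_assoc, F.theta_psi, mul_neg]
    have h₂ : F.coef (D.X b k) * F.psi b * (F.coef (D.Z j c) * F.theta c) =
        F.coef (D.X b k * D.Z j c) * (F.psi b * F.theta c) := by
      rw [mul_assoc, ← mul_assoc (F.psi b), ← (F.coef_psi _ b).eq, map_mul, mul_assoc, mul_assoc]
    rw [h₁, h₂, D.Z_X]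
    have e₁ : (k = j ∧ b = c) ↔ (j = k ∧ b = c) := by rw [eq_comm]
    have e₂ : (b = j ∧ k = c) ↔ (b = j ∧ c = k) := by rw [eq_comm (a := k)]
    simp only [e₁, e₂, map_add, map_sub, add_mul, sub_mul, apply_ite F.coef, map_zero, ite_mul,
      zero_mul]
    abel
  have h₁ : F.zeta D j * F.chi D k =
      ∑ c, ∑ b, F.coef (D.Z j c) * F.theta c * (F.coef (D.X b k) * F.psi b) := by
    simp only [zeta, chi, lin, Finset.sum_mul_sum, Matrix.transpose_apply]
  have h₂ : F.chi D k * F.zeta D j =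
      ∑ c, ∑ b, F.coef (D.X b k) * F.psi b * (F.coef (D.Z j c) * F.theta c) := by
    rw [Finset.sum_comm]
    simp only [zeta, chi, lin, Finset.sum_mul_sum, Matrix.transpose_apply]
  rw [h₁, h₂]
  simp only [key, Finset.sum_add_distrib, Finset.sum_sub_distrib, Finset.sum_neg_distrib]
  congr 2
  · by_cases hjk : j = k <;> simp [hjk, opTau]
  · simp [ite_and]

theorem coef_h_Tau : Commute (F.coef D.h) (F.opTau D) :=
  Commute.sum_right _ _ _ fun j _ =>
    (Commute.refl _).mul_right ((F.coef_psi _ j).mul_right (F.coef_theta _ j))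

theorem Tau_chi (k) : Commute (F.opTau D) (F.chi D k) :=
  Commute.sum_left _ _ _ fun j _ => (F.coef_h_chi D k).mul_left <| by
    rw [commute_iff_eq, mul_assoc, F.theta_chi, mul_neg, ← mul_assoc, F.psi_chi, neg_mul, neg_neg,
      mul_assoc]

theorem Delta_chi (k) : F.opDelta D * F.chi D k =
    F.chi D k * F.opDelta D - F.opTau D * F.chi D k + F.opOmega D * F.theta k := by
  have : ∀ j, F.chi D j * F.zeta D j * F.chi D k = F.chi D k * (F.chi D j * F.zeta D j) -
      (if j = k then F.opTau D * F.chi D j else 0) +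
      F.coef D.h * (F.chi D j * F.psi j) * F.theta k := by
    intro j
    have h₁ : F.chi D j * (F.chi D k * F.zeta D j) =
      -(F.chi D k * (F.chi D j * F.zeta D j)) := by
      rw [← mul_assoc, F.chi_chi, neg_mul, mul_assoc]
    have h₂ : F.chi D j * (F.coef D.h * (F.psi j * F.theta k)) =
        F.coef D.h * (F.chi D j * F.psi j) * F.theta k := by
      rw [← mul_assoc, ← (F.coef_h_chi D j).eq]
      simp only [mul_assoc]
    rw [mul_assoc, F.zeta_chi, mul_add, mul_sub, mul_neg, h₁, h₂, neg_neg, mul_ite, mul_zero,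
      (F.Tau_chi D j).eq]
  rw [opDelta, Finset.sum_mul, Finset.mul_sum, Finset.sum_congr rfl fun j _ => this j,
    Finset.sum_add_distrib, Finset.sum_sub_distrib, opOmega, Finset.sum_mul]
  simp

theorem Delta_Phi : F.opDelta D * F.opPhi D = F.opPhi D * F.opDelta D -
    F.opTau D * F.opPhi D + F.opOmega D * F.opBeta D := by
  rw [opPhi, opBeta]
  simp only [Finset.mul_sum, Finset.sum_mul, ← Finset.sum_sub_distrib, ← Finset.sum_add_distrib]
  refine Finset.sum_congr rfl fun k _ => ?_
  have hxi : Commute (F.opDelta D) (F.xi D k) :=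
    commute_sum_mul (fun j => F.chi_xi D j k) (fun j => F.zeta_xi D j k)
  rw [← mul_assoc, F.Delta_chi, add_mul, sub_mul, mul_assoc, hxi.eq]
  simp only [mul_assoc]

theorem Delta_Omega : F.opDelta D * F.opOmega D = F.opOmega D * F.opDelta D -
    2 * (F.opTau D * F.opOmega D) := by
  have hsum : ∑ k, F.opOmega D * (F.coef D.h * (F.psi k * F.theta k)) =
      F.opTau D * F.opOmega D := by
    rw [← Finset.mul_sum, (F.Tau_Omega D).eq, opTau]
  rw [two_mul]
  nth_rewrite 2 [← hsum]
  have hO : Commute (F.coef D.h) (F.opOmega D) := Commute.sum_right _ _ _ fun j _ =>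
    (Commute.refl _).mul_right ((F.coef_h_chi D j).mul_right (F.coef_psi _ j))
  conv_lhs => rw [opOmega]
  conv_rhs => enter [2, 1]; rw [opOmega]
  conv_rhs => enter [1]; rw [opOmega]
  simp only [Finset.mul_sum, Finset.sum_mul, ← Finset.sum_sub_distrib, ← Finset.sum_add_distrib]
  refine Finset.sum_congr rfl fun k _ => ?_
  have hpsi : Commute (F.opDelta D) (F.psi k) :=
    commute_sum_mul (fun j => neg_swap (F.psi_chi D k j)) (fun j => neg_swap (F.psi_zeta D k j))
  rw [← mul_assoc, ← (F.coef_h_Delta D).eq, mul_assoc, ← mul_assoc (F.opDelta D), F.Delta_chi,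
    add_mul, sub_mul, mul_assoc _ (F.opDelta D), hpsi.eq, mul_assoc _ (F.theta k), F.theta_psi,
    mul_add, mul_sub, mul_neg, mul_neg, ← mul_assoc _ (F.opOmega D), hO.eq, mul_assoc (F.opTau D),
    ← mul_assoc _ (F.opTau D), (F.coef_h_Tau D).eq]
  simp only [mul_assoc]
  abel

end Fermions

/-! ### Twisted commutation and the matching polynomials -/

/-- The commutator of `d` with `f x` is `f x'`. -/
def Derives {R E : Type*} [CommRing R] [Ring E] (f : R →+* E) (d : E) (x x' : R) : Prop :=
  d * f x = f x * d + f x'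

namespace Derives

variable {R E : Type*} [CommRing R] [Ring E] {f : R →+* E} {d : E} {x x' y y' : R}

theorem congr_right (hx : Derives f d x x') (h : x' = y') : Derives f d x y' := h ▸ hx

theorem add (hx : Derives f d x x') (hy : Derives f d y y') :
    Derives f d (x + y) (x' + y') := by
  unfold Derives at *
  rw [map_add, map_add, mul_add, hx, hy, add_mul]
  abel

theorem mul (hx : Derives f d x x') (hy : Derives f d y y') :
    Derives f d (x * y) (x' * y + x * y') := by
  unfold Derives at *
  rw [map_add, map_mul, map_mul, map_mul, ← mul_assoc, hx, add_mul, mul_assoc, hy, mul_add,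
    mul_assoc]
  abel

theorem natCast (k : ℕ) : Derives f d (k : R) 0 := by
  unfold Derives
  rw [map_natCast, map_zero, add_zero, (Nat.cast_commute k d).eq]

theorem one : Derives f d (1 : R) 0 := by
  unfold Derives
  rw [map_one, map_zero, add_zero, one_mul, mul_one]

theorem pow (hx : Derives f d x x') (k : ℕ) :
    Derives f d (x ^ k) (k * x ^ (k - 1) * x') := by
  induction k with
  | zero => simpa using one
  | succ k ih =>
    rw [pow_succ]
    refine (ih.mul hx).congr_right ?_
    rcases k with _ | k
    · simp
    · simp only [Nat.add_sub_cancel, pow_succ]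
      push_cast
      ring

end Derives

section Elimination

variable {R E A : Type*} [CommRing R] [Ring E] [AddCommGroup A]

/-- Relations obtained by annihilating the images of an even derivation `δ` with `δ Φ = γ`,
`δ τ = -Ω`, `δ β = 2 Φ`, `δ Ω = δ γ = 0`. -/
theorem shift_relation {f : R →+* E} {δ : E} {Φ Ω τ β γ : R}
    (hΦ : Derives f δ Φ γ) (hΩ : Derives f δ Ω 0) (hτ : Derives f δ τ (-Ω))
    (hβ : Derives f δ β (2 * Φ)) (hγ : Derives f δ γ 0)
    [IsAddTorsionFree A] (φ : R →+ A) (hφ : ∀ x x', Derives f δ x x' → φ x' = 0) (m p r l : ℕ) :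
    (2 * m + 1) • φ (Ω ^ (r + 1) * β ^ (p + 1) * Φ ^ (2 * m) * γ ^ l) =
      (2 * (p + 1)) • φ (τ * Ω ^ r * β ^ p * Φ ^ (2 * m + 1) * γ ^ l) := by
  induction m generalizing p l with
  | zero =>
    have h₁ := hφ _ _ ((((hτ.mul (hΩ.pow r)).mul (hβ.pow (p + 1))).mul
      (hΦ.pow 0)).mul (hγ.pow l))
    rw [← sub_eq_zero, ← map_nsmul, ← map_nsmul, ← map_sub, ← neg_eq_zero, ← map_neg, ← h₁]
    congr 1
    simp only [nsmul_eq_mul, Nat.add_sub_cancel, pow_succ]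
    push_cast
    ring
  | succ m ih =>
    have h₁ := hφ _ _ ((((hτ.mul (hΩ.pow r)).mul (hβ.pow (p + 1))).mul
      (hΦ.pow (2 * m + 2))).mul (hγ.pow l))
    have h₂ := hφ _ _ ((((hΩ.pow (r + 1)).mul (hβ.pow (p + 2))).mul
      (hΦ.pow (2 * m + 1))).mul (hγ.pow l))
    have h₃ := ih (p + 1) (l + 1)
    set a := φ (Ω ^ (r + 1) * β ^ (p + 1) * Φ ^ (2 * (m + 1)) * γ ^ l) with ha
    set b := φ (τ * Ω ^ r * β ^ p * Φ ^ (2 * (m + 1) + 1) * γ ^ l) with hb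
    set a' := φ (Ω ^ (r + 1) * β ^ (p + 1 + 1) * Φ ^ (2 * m) * γ ^ (l + 1)) with ha'
    set b' := φ (τ * Ω ^ r * β ^ (p + 1) * Φ ^ (2 * m + 1) * γ ^ (l + 1)) with hb'
    have e₁ : a = (2 * (p + 1)) • b + (2 * m + 2) • b' := by
      rw [← sub_eq_zero, ha, hb, hb', ← map_nsmul, ← map_nsmul, ← map_add, ← map_sub,
        ← neg_eq_zero, ← map_neg, ← h₁]
      congr 1
      simp only [nsmul_eq_mul, Nat.add_sub_cancel, pow_succ,
        show 2 * (m + 1) = 2 * m + 1 + 1 by ring,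
        show 2 * m + 2 - 1 = 2 * m + 1 by omega]
      push_cast
      ring
    have e₂ : (2 * (p + 2)) • a + (2 * m + 1) • a' = 0 := by
      rw [ha, ha', ← map_nsmul, ← map_nsmul, ← map_add, ← h₂]
      congr 1
      simp only [nsmul_eq_mul, Nat.add_sub_cancel, pow_succ,
        show 2 * (m + 1) = 2 * m + 1 + 1 by ring,
        show p + 2 - 1 = p + 1 by omega]
      push_cast
      ring
    have e₃ : b' = -a := by
      refine nsmul_right_injective (n := 2 * (p + 2)) (by omega) ?_
      simp only
      rw [smul_neg, eq_neg_iff_add_eq_zero, ← e₂, h₃]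
      rw [show 2 * (p + 1 + 1) = 2 * (p + 2) by ring]
      abel
    rw [e₃] at e₁
    rw [show 2 * (m + 1) + 1 = 1 + (2 * m + 2) by ring, add_smul, one_smul]
    nth_rewrite 1 [e₁]
    rw [smul_neg]
    abel

/-- The number of ways to choose `r` disjoint pairs among `k` points. -/
def pairings (k r : ℕ) : ℕ := k.choose (2 * r) * Nat.doubleFactorial (2 * r - 1)

/-- The matching polynomials. -/
def matching (Φ W : R) (k : ℕ) : R :=
  ∑ r ∈ Finset.range (k + 1), (pairings k r : R) * (W ^ r * Φ ^ (k - 2 * r))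

theorem pairings_zero_right (k : ℕ) : pairings k 0 = 1 := by simp [pairings]

theorem pairings_eq_zero {k r : ℕ} (h : k < 2 * r) : pairings k r = 0 := by
  rw [pairings, Nat.choose_eq_zero_of_lt h, zero_mul]

theorem pairings_succ_succ (k r : ℕ) :
    pairings (k + 2) (r + 1) = pairings (k + 1) (r + 1) + (k + 1) * pairings k r := by
  have h₁ : Nat.doubleFactorial (2 * (r + 1) - 1) =
      (2 * r + 1) * Nat.doubleFactorial (2 * r - 1) := by
    rcases r with _ | r
    · rfl
    · exact Nat.doubleFactorial_add_two _
  have h₂ := Nat.add_one_mul_choose_eq k (2 * r)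
  rw [pairings, pairings, pairings, h₁, show 2 * (r + 1) = 2 * r + 1 + 1 by ring,
    Nat.choose_succ_succ (k + 1), ← mul_assoc (k + 1) (k.choose _), h₂]
  simp only [Nat.succ_eq_add_one]
  ring

theorem pairings_mul (k r : ℕ) :
    (k + 1) * (k - 2 * r) * pairings k r = 2 * (r + 1) * pairings (k + 1) (r + 1) := by
  have h₁ : Nat.doubleFactorial (2 * (r + 1) - 1) =
      (2 * r + 1) * Nat.doubleFactorial (2 * r - 1) := by
    rcases r with _ | r
    · rfl
    · exact Nat.doubleFactorial_add_two _
  have h₂ := Nat.add_one_mul_choose_eq k (2 * r + 1)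
  have h₃ := Nat.choose_succ_right_eq k (2 * r)
  rw [pairings, pairings, h₁, show 2 * (r + 1) = 2 * r + 1 + 1 by ring]
  calc _ = (k + 1) * (k.choose (2 * r) * (k - 2 * r)) * Nat.doubleFactorial (2 * r - 1) := by ring
    _ = ((k + 1) * k.choose (2 * r + 1)) * (2 * r + 1) *
        Nat.doubleFactorial (2 * r - 1) := by rw [← h₃]; ring
    _ = _ := by rw [h₂]; ring

theorem matching_zero (Φ W : R) : matching Φ W 0 = 1 := by
  simp [matching, pairings]

theorem matching_one (Φ W : R) : matching Φ W 1 = Φ := by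
  simp [matching, Finset.sum_range_succ, pairings]

theorem matching_add_two (Φ W : R) (k : ℕ) :
    matching Φ W (k + 2) = Φ * matching Φ W (k + 1) + (k + 1) * W * matching Φ W k := by
  have hlast : matching Φ W k = ∑ r ∈ Finset.range (k + 1 + 1),
      (pairings k r : R) * (W ^ r * Φ ^ (k - 2 * r)) := by
    rw [Finset.sum_range_succ, pairings_eq_zero (by omega)]
    simp [matching]
  have hmid : matching Φ W (k + 1) = ∑ r ∈ Finset.range (k + 1 + 1 + 1),
      (pairings (k + 1) r : R) * (W ^ r * Φ ^ (k + 1 - 2 * r)) := by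
    rw [Finset.sum_range_succ _ (k + 1 + 1), pairings_eq_zero (by omega)]
    simp [matching]
  rw [hlast, hmid, matching, Finset.sum_range_succ', Finset.sum_range_succ' _ (k + 1 + 1), mul_add,
    Finset.mul_sum, Finset.mul_sum, add_right_comm, ← Finset.sum_add_distrib]
  congr 1
  · refine Finset.sum_congr rfl fun r _ => ?_
    rw [pairings_succ_succ, show k + 2 - 2 * (r + 1) = k - 2 * r by omega]
    by_cases hr : k + 1 < 2 * (r + 1)
    · rw [pairings_eq_zero hr]
      push_cast
      ring
    · rw [show k - 2 * r = (k + 1 - 2 * (r + 1)) + 1 by omega]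
      push_cast
      ring
  · simp only [pairings_zero_right, mul_zero, Nat.sub_zero]
    ring

theorem derives_matching {f : R →+* E} {d : E} {Φ W τ : R} (hΦ : Derives f d Φ (-(τ * Φ) + W))
    (hW : Derives f d W (-(2 * τ * W))) (k : ℕ) :
    Derives f d (matching Φ W (k + 1))
      ((k + 1) * (W * matching Φ W k - τ * matching Φ W (k + 1))) := by
  induction k using Nat.twoStepInduction with
  | zero =>
    rw [zero_add, matching_zero, matching_one]
    exact hΦ.congr_right (by push_cast; ring)
  | one =>
    have h₂ : matching Φ W (1 + 1) = Φ * Φ + W := by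
      have := matching_add_two Φ W 0
      rw [zero_add, zero_add, matching_zero, matching_one] at this
      rw [this]; push_cast; ring
    rw [h₂, matching_one]
    exact ((hΦ.mul hΦ).add hW).congr_right (by push_cast; ring)
  | more k ih₁ ih₂ =>
    rw [show k + 2 + 1 = (k + 1) + 2 by ring, matching_add_two Φ W (k + 1)]
    refine ((hΦ.mul ih₂).add (((((Derives.natCast (k + 1)).add Derives.one).mul hW).mul
      ih₁))).congr_right ?_
    have h₁ := matching_add_two Φ W k
    rw [show k + 1 + 1 = k + 2 by ring] at *
    push_cast
    linear_combination (-(k + 2) * W) * h₁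

/-- Annihilating commutators with `δ` cancels all the corrections in the matching polynomial. -/
theorem matching_sub_eq {f : R →+* E} {δ : E} {Φ Ω τ β γ : R}
    (hΦ : Derives f δ Φ γ) (hΩ : Derives f δ Ω 0) (hτ : Derives f δ τ (-Ω))
    (hβ : Derives f δ β (2 * Φ)) (hγ : Derives f δ γ 0)
    [IsAddTorsionFree A] (φ : R →+ A) (hφ : ∀ x x', Derives f δ x x' → φ x' = 0) {k : ℕ}
    (hk : Odd k) :
    φ (matching Φ (Ω * β) (k + 1) - (k + 1) * (τ * matching Φ (Ω * β) k)) = φ (Φ ^ (k + 1)) := by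
  have hterm : ∀ r, φ ((pairings (k + 1) (r + 1) : R) *
      ((Ω * β) ^ (r + 1) * Φ ^ (k + 1 - 2 * (r + 1)))) =
      φ ((k + 1) * (τ * ((pairings k r : R) * ((Ω * β) ^ r * Φ ^ (k - 2 * r))))) := by
    intro r
    obtain ⟨j, rfl⟩ := hk
    by_cases hr : 2 * j + 1 < 2 * r
    · rw [pairings_eq_zero hr, pairings_eq_zero (by omega)]
      simp
    obtain ⟨m, rfl⟩ : ∃ m, j = r + m := ⟨j - r, by omega⟩
    have h₁ := shift_relation hΦ hΩ hτ hβ hγ φ hφ m r r 0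
    have h₂ := pairings_mul (2 * (r + m) + 1) r
    refine nsmul_right_injective (n := 2 * m + 1) (by omega) ?_
    simp only
    have e₁ : (pairings (2 * (r + m) + 1 + 1) (r + 1) : R) *
        ((Ω * β) ^ (r + 1) * Φ ^ (2 * (r + m) + 1 + 1 - 2 * (r + 1))) =
        pairings (2 * (r + m) + 1 + 1) (r + 1) •
          (Ω ^ (r + 1) * β ^ (r + 1) * Φ ^ (2 * m) * γ ^ 0) := by
      rw [nsmul_eq_mul, show 2 * (r + m) + 1 + 1 - 2 * (r + 1) = 2 * m by omega]
      ring
    have e₂ : ((2 * (r + m) + 1 : ℕ) + 1 : R) * (τ * ((pairings (2 * (r + m) + 1) r : R) *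
        ((Ω * β) ^ r * Φ ^ (2 * (r + m) + 1 - 2 * r)))) =
        ((2 * (r + m) + 1 + 1) * pairings (2 * (r + m) + 1) r) •
          (τ * Ω ^ r * β ^ r * Φ ^ (2 * m + 1) * γ ^ 0) := by
      rw [nsmul_eq_mul, show 2 * (r + m) + 1 - 2 * r = 2 * m + 1 by omega]
      push_cast
      ring
    rw [e₁, e₂, map_nsmul, map_nsmul, smul_comm, h₁, smul_smul, smul_smul, mul_comm _ (2 * _),
      ← h₂, show 2 * (r + m) + 1 - 2 * r = 2 * m + 1 by omega]
    congr 1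
    ring
  rw [matching, Finset.sum_range_succ', matching, Finset.mul_sum, Finset.mul_sum, map_sub,
    map_add, map_sum, map_sum, Finset.sum_congr rfl fun r _ => hterm r, add_sub_cancel_left]
  simp [pairings_zero_right]

/-- Products of shifts of `f Φ + Δ`, evaluated by a functional that kills `Δ` on the right. -/
theorem ev_prod_eq {f : R →+* E} {Δ : E} {Φ W τ : R} (hΦ : Derives f Δ Φ (-(τ * Φ) + W))
    (hW : Derives f Δ W (-(2 * τ * W))) (ev : E →+ A) (hev : ∀ u, ev (u * Δ) = 0)
    (P : ℕ → E) (hP₀ : P 0 = 1) (hP : ∀ k, P (k + 1) = (f Φ + Δ + k * f τ) * P k) (k : ℕ) (u : E) :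
    ev (u * P k) = ev (u * f (matching Φ W k)) := by
  induction k generalizing u with
  | zero => rw [hP₀, matching_zero, map_one]
  | succ k ih =>
    rw [hP, ← mul_assoc, ih]
    rcases k with _ | k
    · rw [matching_zero, zero_add, matching_one, map_one, mul_one, mul_add, mul_add, map_add,
        map_add, hev]
      simp
    · have hd := derives_matching hΦ hW k
      unfold Derives at hd
      have : u * (f Φ + Δ + (k + 1 : ℕ) * f τ) * f (matching Φ W (k + 1)) =
          u * f (matching Φ W (k + 1 + 1)) + u * f (matching Φ W (k + 1)) * Δ := by
        rw [mul_assoc, add_mul, add_mul, hd, matching_add_two Φ W k]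
        simp only [map_add, map_mul, map_sub, map_natCast, map_one, Nat.cast_add, Nat.cast_one]
        have hc : f τ * f (matching Φ W (k + 1)) = f (τ * matching Φ W (k + 1)) := (map_mul ..).symm
        noncomm_ring
      rw [this, map_add, hev, add_zero]

theorem ev_shifted_prod_eq {f : R →+* E} {δ Δ : E} {Φ Ω τ β γ : R}
    (hΦ : Derives f δ Φ γ) (hΩ : Derives f δ Ω 0) (hτ : Derives f δ τ (-Ω))
    (hβ : Derives f δ β (2 * Φ)) (hγ : Derives f δ γ 0)
    (hΔΦ : Derives f Δ Φ (-(τ * Φ) + Ω * β)) (hΔΩ : Derives f Δ Ω (-(2 * τ * Ω)))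
    (hΔβ : Derives f Δ β 0) (hΔτ : Derives f Δ τ 0)
    (ev : E →+ A) (hδ₁ : ∀ u, ev (δ * u) = 0) (hδ₂ : ∀ u, ev (u * δ) = 0)
    (hΔ : ∀ u, ev (u * Δ) = 0) [IsAddTorsionFree A] {n : ℕ} (hn : Even n)
    (hpos : 0 < n) : ev ((List.range n).map fun i : ℕ => f Φ + Δ + ((n : E) - 2 - i) * f τ).prod =
      ev (f Φ ^ n) := by
  obtain ⟨k, rfl⟩ : ∃ k, n = k + 1 := ⟨n - 1, by omega⟩
  have hk : Odd k := by
    rw [Nat.even_add_one, Nat.not_even_iff_odd] at hn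
    exact hn
  let P : ℕ → E := fun j => Nat.rec 1 (fun i p => (f Φ + Δ + i * f τ) * p) j
  have hP : ∀ j, P (j + 1) = (f Φ + Δ + j * f τ) * P j := fun j => rfl
  have hlist : ∀ j : ℕ,
      ((List.range j).map fun i : ℕ => f Φ + Δ + ((j : E) - 1 - i) * f τ).prod = P j := by
    intro j
    induction j with
    | zero => rfl
    | succ j ih =>
      rw [hP, ← ih, List.range_succ_eq_map, List.map_cons, List.prod_cons, List.map_map]
      congr 2
      · push_cast
        simp
      · refine List.map_congr_left fun i _ => ?_
        simp only [Function.comp_apply, Nat.succ_eq_add_one]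
        push_cast
        congr 2
        abel
  have hcτ : Commute (f Φ + Δ) (f τ) := by
    refine Commute.add_left (by rw [commute_iff_eq, ← map_mul, ← map_mul, mul_comm]) ?_
    unfold Derives at hΔτ
    rw [commute_iff_eq, hΔτ, map_zero, add_zero]
  have hcomm : ∀ j, Commute (f Φ + Δ - f τ) (P j) := by
    intro j
    induction j with
    | zero => exact Commute.one_right _
    | succ j ih =>
      refine Commute.mul_right (Commute.add_right ?_ ?_) ih
      · exact (Commute.refl _).sub_left hcτ.symm
      · exact (Nat.cast_commute j _).symm.mul_right (hcτ.sub_left (Commute.refl _))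
  have hW : Derives f Δ (Ω * β) (-(2 * τ * (Ω * β))) :=
    (hΔΩ.mul hΔβ).congr_right (by ring)
  have hprod : ((List.range (k + 1)).map fun i : ℕ =>
      f Φ + Δ + (((k + 1 : ℕ) : E) - 2 - i) * f τ).prod =
      P (k + 1) - f (k + 1) * f τ * P k := by
    have e : (f Φ + Δ + (((k + 1 : ℕ) : E) - 2 - k) * f τ) = f Φ + Δ - f τ := by
      rw [show (((k + 1 : ℕ) : E) - 2 - k) = -1 by
        rw [← one_add_one_eq_two]; push_cast; abel, neg_one_mul, sub_eq_add_neg]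
    rw [List.range_succ, List.map_append, List.prod_append, List.map_singleton,
      List.prod_singleton, e, hP, map_add, map_one, map_natCast]
    have : ((List.range k).map fun i : ℕ =>
        f Φ + Δ + (((k + 1 : ℕ) : E) - 2 - i) * f τ) =
        (List.range k).map fun i : ℕ => f Φ + Δ + ((k : E) - 1 - i) * f τ := by
      refine List.map_congr_left fun i _ => ?_
      congr 2
      rw [← one_add_one_eq_two]
      push_cast
      abel
    rw [this, hlist, ← (hcomm k).eq, ← sub_mul]
    congr 1
    noncomm_ring
  have hφ : ∀ x x', Derives f δ x x' → (ev.comp f.toAddMonoidHom) x' = 0 := by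
    intro x x' hx
    unfold Derives at hx
    have := congrArg ev hx
    rw [hδ₁, map_add, hδ₂, zero_add] at this
    exact this.symm
  have hS := matching_sub_eq hΦ hΩ hτ hβ hγ (ev.comp f.toAddMonoidHom) hφ hk
  have h₁ := ev_prod_eq hΔΦ hW ev hΔ P rfl hP (k + 1) 1
  rw [hprod, map_sub, ← one_mul (P (k + 1)), h₁, ev_prod_eq hΔΦ hW ev hΔ P rfl hP, one_mul,
    ← map_mul, ← map_mul, ← map_sub, ← map_sub, ← map_pow, mul_assoc]
  exact hS

end Elimination

/-! ### Evaluating the two products -/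

namespace Fermions

variable {C E A : Type*} [Ring C] [Ring E] [AddCommGroup A] {n : ℕ} (F : Fermions C E n)
  (D : CapelliData C n)

theorem ev_prod_opPhi_eq (ev : E →+ A) (hdel₁ : ∀ u j, ev (F.del j * u) = 0)
    (hdel₂ : ∀ u j, ev (u * F.del j) = 0) (hZ : ∀ u j k, ev (u * F.coef (D.Z j k)) = 0)
    [IsAddTorsionFree A] (hn : Even n) (hpos : 0 < n) :
    ev ((List.range n).map fun i : ℕ =>
      F.opPhi D + F.opDelta D + ((n : E) - 2 - i) * F.opTau D).prod = ev (F.opPhi D ^ n) := by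
  set s : Set E := {F.opPhi D, F.opOmega D, F.opTau D, F.opBeta D, F.opGamma D} with hs
  have hcomm : ∀ a ∈ s, ∀ b ∈ s, a * b = b * a := by
    have h₁ := (F.Phi_Omega D).eq
    have h₂ := (F.Phi_Tau D).eq
    have h₃ := (F.Phi_Beta D).eq
    have h₄ := (F.Phi_Gamma D).eq
    have h₅ := (F.Beta_Omega D).eq
    have h₆ := (F.Beta_Tau D).eq
    have h₇ := (F.Beta_Gamma D).eq
    have h₈ := (F.Gamma_Omega D).eq
    have h₉ := (F.Gamma_Tau D).eq
    have h₀ := (F.Tau_Omega D).eq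
    simp only [hs, Set.mem_insert_iff, Set.mem_singleton_iff]
    rintro _ (rfl | rfl | rfl | rfl | rfl) _ (rfl | rfl | rfl | rfl | rfl) <;>
      first | rfl | assumption | (symm; assumption)
  let _ : CommRing (Subring.closure s) :=
    { (inferInstance : Ring (Subring.closure s)) with
      mul_comm := (Subring.isMulCommutative_closure hcomm).is_comm.comm }
  let f : Subring.closure s →+* E := (Subring.closure s).subtype
  let Φ : Subring.closure s := ⟨F.opPhi D, Subring.subset_closure (by simp [hs])⟩
  let Ω : Subring.closure s := ⟨F.opOmega D, Subring.subset_closure (by simp [hs])⟩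
  let τ : Subring.closure s := ⟨F.opTau D, Subring.subset_closure (by simp [hs])⟩
  let β : Subring.closure s := ⟨F.opBeta D, Subring.subset_closure (by simp [hs])⟩
  let γ : Subring.closure s := ⟨F.opGamma D, Subring.subset_closure (by simp [hs])⟩
  have fΦ : f Φ = F.opPhi D := rfl
  have fΩ : f Ω = F.opOmega D := rfl
  have fτ : f τ = F.opTau D := rfl
  have fβ : f β = F.opBeta D := rfl
  have fγ : f γ = F.opGamma D := rfl
  have hδ₁ : ∀ u, ev (F.opShift D * u) = 0 := by
    intro u
    rw [opShift, Finset.sum_mul, map_sum]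
    refine Finset.sum_eq_zero fun j _ => ?_
    rw [neg_swap (F.del_chi D j j), neg_mul, map_neg, mul_assoc, hdel₁, neg_zero]
  have hδ₂ : ∀ u, ev (u * F.opShift D) = 0 := by
    intro u
    rw [opShift, Finset.mul_sum, map_sum]
    refine Finset.sum_eq_zero fun j _ => ?_
    rw [← mul_assoc, hdel₂]
  have hΔ : ∀ u, ev (u * F.opDelta D) = 0 := by
    intro u
    rw [opDelta, Finset.mul_sum, map_sum]
    refine Finset.sum_eq_zero fun j _ => ?_
    rw [zeta, lin, Finset.mul_sum, Finset.mul_sum, map_sum]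
    refine Finset.sum_eq_zero fun c _ => ?_
    rw [(F.coef_theta _ c).eq, ← mul_assoc, ← mul_assoc]
    exact hZ _ _ _
  refine ev_shifted_prod_eq (f := f) (δ := F.opShift D) (Δ := F.opDelta D) (Φ := Φ) (Ω := Ω)
    (τ := τ) (β := β) (γ := γ) ?_ ?_ ?_ ?_ ?_ ?_ ?_ ?_ ?_ ev hδ₁ hδ₂ hΔ hn hpos <;>
    unfold Derives <;>
    simp only [map_add, map_neg, map_mul, map_zero, map_ofNat, add_zero, fΦ, fΩ, fτ, fβ, fγ]
  · exact F.Shift_Phi D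
  · exact (F.Shift_Omega D).eq
  · rw [F.Shift_Tau, sub_eq_add_neg]
  · exact F.Shift_Beta D
  · exact (F.Shift_Gamma D).eq
  · rw [F.Delta_Phi, sub_eq_add_neg, add_assoc]
  · rw [F.Delta_Omega, sub_eq_add_neg, mul_assoc]
  · exact (F.Delta_Beta D).eq
  · exact (F.Delta_Tau D).eq

/-! Top-degree coefficients. -/

theorem list_prod_perm_pair {n : ℕ} {x : Fin n → E} (hx : ∀ i j, Commute (x i) (x j))
    {i j : Fin n} (hij : i ≠ j) : ((List.finRange n).map x).prod =
      x i * (x j * ((((List.finRange n).erase i).erase j).map x).prod) := by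
  have hp : (List.finRange n).Perm (i :: j :: ((List.finRange n).erase i).erase j) :=
    (List.perm_cons_erase (List.mem_finRange i)).trans <| List.Perm.cons _ <|
      List.perm_cons_erase ((List.mem_erase_of_ne hij.symm).2 (List.mem_finRange j))
  rw [(hp.map x).prod_eq', List.map_cons, List.map_cons, List.prod_cons, List.prod_cons]
  rw [List.pairwise_map]
  exact List.pairwise_of_forall fun a b => hx a b

theorem psi_theta_commute (a b c d : Fin n) :
    Commute (F.psi a * F.theta b) (F.psi c * F.theta d) :=
  commute_mul_mul_of_anticommute (F.psi_psi _ _) (F.psi_theta _ _) (F.theta_psi _ _)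
    (F.theta_theta _ _)

theorem psi_theta_mul (a b c d : Fin n) : F.psi a * F.theta b * (F.psi c * F.theta d) =
    -(F.psi a * F.psi c * (F.theta b * F.theta d)) := by
  rw [mul_assoc, ← mul_assoc (F.theta b), F.theta_psi]
  noncomm_ring

/-- The monomial `∏ ψ_{f c} θ_c`. -/
def monomial (f : Fin n → Fin n) : E :=
  ((List.finRange n).map fun c => F.psi (f c) * F.theta c).prod

theorem monomial_eq_zero {f : Fin n → Fin n} (hf : ¬ Function.Injective f) :
    F.monomial f = 0 := by
  simp only [Function.Injective, not_forall] at hf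
  obtain ⟨i, j, hij, hne⟩ := hf
  rw [monomial, list_prod_perm_pair (fun i j => F.psi_theta_commute _ _ _ _) hne, ← mul_assoc,
    F.psi_theta_mul, hij, F.psi_sq, zero_mul, neg_zero, zero_mul]

theorem monomial_swap (f : Fin n → Fin n) {i j : Fin n} (hij : i ≠ j) :
    F.monomial (f ∘ Equiv.swap i j) = -F.monomial f := by
  rw [monomial, monomial, list_prod_perm_pair (fun i j => F.psi_theta_commute _ _ _ _) hij,
    list_prod_perm_pair (fun i j => F.psi_theta_commute _ _ _ _) hij,
    ← mul_assoc (F.psi _ * F.theta i) (F.psi _ * F.theta j),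
    ← mul_assoc (F.psi _ * F.theta i) (F.psi _ * F.theta j), F.psi_theta_mul, F.psi_theta_mul]
  have : (((List.finRange n).erase i).erase j).map
      (fun c => F.psi ((f ∘ Equiv.swap i j) c) * F.theta c) =
      (((List.finRange n).erase i).erase j).map (fun c => F.psi (f c) * F.theta c) := by
    refine List.map_congr_left fun c hc => ?_
    have hnd := List.nodup_finRange n
    have hcj : c ≠ j := ((hnd.erase i).mem_erase_iff.1 hc).1
    have hci : c ≠ i := (hnd.mem_erase_iff.1 ((hnd.erase i).mem_erase_iff.1 hc).2).1
    rw [Function.comp_apply, Equiv.swap_apply_of_ne_of_ne hci hcj]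
  rw [this, Function.comp_apply, Function.comp_apply, Equiv.swap_apply_left,
    Equiv.swap_apply_right, F.psi_psi (f j)]
  noncomm_ring

theorem monomial_perm (σ : Equiv.Perm (Fin n)) :
    F.monomial σ = (Equiv.Perm.sign σ : ℤ) • F.monomial id := by
  induction σ using Equiv.Perm.swap_induction_on' with
  | one => simp
  | mul_swap f x y hxy ih =>
    rw [Equiv.Perm.coe_mul, F.monomial_swap _ hxy, ih, Equiv.Perm.sign_mul,
      Equiv.Perm.sign_swap hxy]
    simp

theorem prod_lin_mul_theta (M : Matrix (Fin n) (Fin n) C) :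
    ((List.finRange n).map fun c => F.lin F.psi M c * F.theta c).prod =
      F.coef (cdet M) * F.monomial id := by
  have hmono : ∀ (f : Fin n → Fin n) (l : List (Fin n)),
      (l.map fun c => F.coef (M (f c) c) * (F.psi (f c) * F.theta c)).prod =
        F.coef (l.map fun c => M (f c) c).prod *
          (l.map fun c => F.psi (f c) * F.theta c).prod := by
    intro f l
    induction l with
    | nil => simp
    | cons c l ih =>
      have := (F.coef_psi (l.map fun c => M (f c) c).prod (f c)).mul_right
        (F.coef_theta (l.map fun c => M (f c) c).prod c)
      rw [List.map_cons, List.prod_cons, ih, List.map_cons, List.prod_cons, List.map_cons,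
        List.prod_cons, map_mul, mul_assoc (F.coef _), this.symm.left_comm]
      simp only [mul_assoc]
  have hexp : ((List.finRange n).map fun c => F.lin F.psi M c * F.theta c).prod =
      ∑ f : Fin n → Fin n,
        F.coef ((List.finRange n).map fun c => M (f c) c).prod * F.monomial f := by
    have := (MultilinearMap.mkPiAlgebraFin ℤ n E).map_sum
      (fun (c a : Fin n) => F.coef (M a c) * (F.psi a * F.theta c))
    simp only [MultilinearMap.mkPiAlgebraFin_apply, List.ofFn_eq_map] at this
    simp only [lin, Finset.sum_mul, mul_assoc, this, hmono]
    rfl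
  rw [hexp, cdet, map_sum, Finset.sum_mul]
  symm
  refine Finset.sum_of_injOn (fun σ : Equiv.Perm (Fin n) => (σ : Fin n → Fin n))
    (fun _ _ _ _ h => DFunLike.coe_injective h) (fun _ _ => Finset.mem_coe.2 (Finset.mem_univ _))
    (fun f _ hf => ?_) (fun σ _ => ?_)
  · rw [F.monomial_eq_zero, mul_zero]
    intro hinj
    exact hf ⟨Equiv.ofBijective f (Finite.injective_iff_bijective.1 hinj), by simp, by ext; simp⟩
  · rw [F.monomial_perm, map_zsmul, smul_mul_assoc, mul_smul_comm]

end Fermions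

namespace Fermions

variable {C E A : Type*} [Ring C] [Ring E] [AddCommGroup A] {n : ℕ} (F : Fermions C E n)
  (D : CapelliData C n)

theorem lin_psi_mul (M : Matrix (Fin n) (Fin n) C) (c : Fin n) :
    F.lin F.psi (D.X * M) c = ∑ j, F.chi D j * F.coef (M j c) := by
  simp only [lin, chi, Matrix.mul_apply, map_sum, Finset.sum_mul]
  rw [Finset.sum_comm]
  refine Finset.sum_congr rfl fun j _ => Finset.sum_congr rfl fun a _ => ?_
  rw [map_mul, mul_assoc, mul_assoc, (F.coef_psi _ a).eq]

theorem sum_lin_psi_mul_theta (M : Matrix (Fin n) (Fin n) C) :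
    ∑ c, F.lin F.psi (D.X * M) c * F.theta c = ∑ j, F.chi D j * F.lin F.theta Mᵀ j := by
  simp only [lin_psi_mul, Finset.sum_mul]
  rw [Finset.sum_comm]
  simp only [lin, Finset.mul_sum, Matrix.transpose_apply, mul_assoc]

/-- The combination of the `psi` along a column of the noncommuting product. -/
def mu (c : Fin n) : E := F.lin F.psi (D.X * (D.Y + D.Z)) c

theorem sum_mu_mul_theta : ∑ c, F.mu D c * F.theta c = F.opPhi D + F.opDelta D := by
  simp only [mu, sum_lin_psi_mul_theta, opPhi, opDelta, ← Finset.sum_add_distrib, ← mul_add]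
  refine Finset.sum_congr rfl fun j _ => ?_
  congr 1
  simp only [lin, xi, zeta, ← Finset.sum_add_distrib, ← add_mul, Matrix.transpose_apply,
    Matrix.add_apply, map_add]

theorem psi_mu (j c) : F.psi j * F.mu D c = -(F.mu D c * F.psi j) :=
  F.anticommute_lin (fun c => F.coef_psi c j) (F.psi_psi j) _ _

theorem theta_mu (j c) : F.theta j * F.mu D c = -(F.mu D c * F.theta j) :=
  F.anticommute_lin (fun c => F.coef_theta c j) (F.theta_psi j) _ _

theorem coef_YZ_chi (j c k : Fin n) : F.coef ((D.Y + D.Z) j c) * F.chi D k =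
    F.chi D k * F.coef ((D.Y + D.Z) j c) + ((if j = k then F.coef D.h * F.psi c else 0) -
      (if c = k then F.coef D.h * F.psi j else 0)) := by
  have key : ∀ a, F.coef ((D.Y + D.Z) j c) * (F.coef (D.X a k) * F.psi a) =
      F.coef (D.X a k) * F.psi a * F.coef ((D.Y + D.Z) j c) +
        ((if j = k ∧ a = c then F.coef D.h * F.psi a else 0) -
        (if c = k ∧ a = j then F.coef D.h * F.psi a else 0)) := by
    intro a
    have e₁ : (k = j ∧ a = c) ↔ (j = k ∧ a = c) := by rw [eq_comm]
    have e₂ : (a = j ∧ k = c) ↔ (c = k ∧ a = j) := by rw [eq_comm (a := k), and_comm]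
    rw [mul_assoc (F.coef (D.X a k)), ← (F.coef_psi _ a).eq, ← mul_assoc, ← map_mul, ← mul_assoc,
      ← map_mul, Matrix.add_apply, add_mul, mul_add, D.Z_X, (D.X_Y a k j c).eq, ← add_assoc]
    simp only [e₁, e₂, map_add, map_sub, add_mul, sub_mul, apply_ite F.coef, map_zero, ite_mul,
      zero_mul]
  simp only [chi, lin, Finset.mul_sum, Finset.sum_mul, key, Finset.sum_add_distrib,
    Finset.sum_sub_distrib]
  congr 2
  · by_cases h : j = k <;> simp [h]
  · by_cases h : c = k <;> simp [h]

theorem coef_h_mu (c) : Commute (F.coef D.h) (F.mu D c) := by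
  refine F.coef_lin F.coef_psi (fun i j => ?_) c
  rw [Matrix.mul_apply]
  exact Commute.sum_right _ _ _ fun _ _ =>
    (D.h_X _ _).mul_right ((D.h_Y _ _).add_right (D.h_Z _ _))

theorem YZ_YZ (i j k l : Fin n) : Commute ((D.Y + D.Z) i j) ((D.Y + D.Z) k l) :=
  ((D.Y_Y _ _ _ _).add_left (D.Y_Z _ _ _ _).symm).add_right
    ((D.Y_Z _ _ _ _).add_left (D.Z_Z _ _ _ _))

theorem mu_mul_mu (c e : Fin n) : F.mu D c * F.mu D e =
    (∑ j, ∑ k, F.chi D j * F.chi D k * F.coef ((D.Y + D.Z) j c * (D.Y + D.Z) k e)) -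
      F.coef D.h * (F.psi c * F.mu D e) -
      (∑ j, F.chi D j * (F.coef D.h * F.psi j)) * F.coef ((D.Y + D.Z) c e) := by
  have hμ : ∀ c, F.mu D c = ∑ j, F.chi D j * F.coef ((D.Y + D.Z) j c) := fun c =>
    F.lin_psi_mul D _ c
  have hψ : F.coef D.h * (F.psi c * F.mu D e) =
      -∑ j, F.chi D j * (F.coef D.h * F.psi c) * F.coef ((D.Y + D.Z) j e) := by
    rw [hμ, Finset.mul_sum, Finset.mul_sum, ← Finset.sum_neg_distrib]
    refine Finset.sum_congr rfl fun j _ => ?_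
    rw [← mul_assoc (F.psi c), F.psi_chi, neg_mul, mul_neg, ← mul_assoc (F.chi D j) (F.coef D.h),
      ← (F.coef_h_chi D j).eq]
    simp only [mul_assoc]
  have key : ∀ j k, F.chi D j * F.coef ((D.Y + D.Z) j c) *
      (F.chi D k * F.coef ((D.Y + D.Z) k e)) =
      F.chi D j * F.chi D k * F.coef ((D.Y + D.Z) j c * (D.Y + D.Z) k e) +
      (if j = k then F.chi D j * (F.coef D.h * F.psi c) * F.coef ((D.Y + D.Z) k e) else 0) -
      (if c = k then F.chi D j * (F.coef D.h * F.psi j) * F.coef ((D.Y + D.Z) k e) else 0) := by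
    intro j k
    rw [mul_assoc, ← mul_assoc (F.coef _), F.coef_YZ_chi, map_mul]
    split_ifs <;> noncomm_ring
  rw [hμ c, hμ e, Finset.sum_mul_sum]
  simp only [key, Finset.sum_add_distrib, Finset.sum_sub_distrib, Finset.sum_ite_eq,
    Finset.mem_univ, if_true]
  rw [← hμ e, hψ, Finset.sum_mul, sub_neg_eq_add]

theorem mu_mul_mu_add (c e : Fin n) : F.mu D c * F.mu D e + F.mu D e * F.mu D c =
    -(F.coef D.h * (F.psi c * F.mu D e + F.psi e * F.mu D c)) := by
  have h₁ : ∑ j, ∑ k, F.chi D j * F.chi D k * F.coef ((D.Y + D.Z) j e * (D.Y + D.Z) k c) =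
      -∑ j, ∑ k, F.chi D j * F.chi D k * F.coef ((D.Y + D.Z) j c * (D.Y + D.Z) k e) := by
    rw [Finset.sum_comm]
    simp only [← Finset.sum_neg_distrib]
    refine Finset.sum_congr rfl fun j _ => Finset.sum_congr rfl fun k _ => ?_
    rw [F.chi_chi, neg_mul, (YZ_YZ D _ _ _ _).eq]
  have h₂ : (D.Y + D.Z) e c = -(D.Y + D.Z) c e := by
    rw [Matrix.add_apply, Matrix.add_apply, D.Y_anti, D.Z_anti, neg_add]
  rw [F.mu_mul_mu, F.mu_mul_mu, h₁, h₂, map_neg, mul_add]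
  noncomm_ring

/-- The shifted version of `mu`. -/
def shiftedMu (d : ℤ) (c : Fin n) : E := F.mu D c + d * (F.coef D.h * F.psi c)

theorem shiftedMu_mul (d : ℤ) (c e : Fin n) : F.shiftedMu D (d + 1) c * F.shiftedMu D d e =
    -(F.shiftedMu D (d + 1) e * F.shiftedMu D d c) := by
  have hmul : ∀ c e, F.shiftedMu D (d + 1) c * F.shiftedMu D d e =
      F.mu D c * F.mu D e - d * (F.coef D.h * (F.psi e * F.mu D c)) +
        (d + 1) * (F.coef D.h * (F.psi c * F.mu D e)) +
        (d + 1) * d * (F.coef D.h * F.coef D.h * (F.psi c * F.psi e)) := by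
    intro c e
    have h₁ : F.mu D c * (d * (F.coef D.h * F.psi e)) =
        -(d * (F.coef D.h * (F.psi e * F.mu D c))) := by
      rw [← mul_assoc, ← (Int.cast_commute d _).eq, mul_assoc, ← mul_assoc (F.mu D c),
        ← (F.coef_h_mu D c).eq, mul_assoc, neg_swap (F.psi_mu D e c), mul_neg, mul_neg]
    have h₂ : ((d : E) + 1) * (F.coef D.h * F.psi c) * (d * (F.coef D.h * F.psi e)) =
        (d + 1) * d * (F.coef D.h * F.coef D.h * (F.psi c * F.psi e)) := by
      have h₃ : F.psi c * (F.coef D.h * F.psi e) = F.coef D.h * (F.psi c * F.psi e) := by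
        rw [← mul_assoc, ← (F.coef_psi _ c).eq, mul_assoc]
      rw [mul_assoc, ← mul_assoc (F.coef D.h * _), ← (Int.cast_commute d _).eq, mul_assoc (d : E),
        mul_assoc (F.coef D.h), h₃]
      simp only [mul_assoc]
    rw [shiftedMu, shiftedMu, add_mul, mul_add, mul_add, Int.cast_add, Int.cast_one, h₁, h₂]
    simp only [mul_assoc]
    abel
  rw [hmul, hmul, eq_neg_iff_add_eq_zero, F.psi_psi e c]
  have := F.mu_mul_mu_add D c e
  rw [← sub_eq_zero] at this
  rw [← this]
  noncomm_ring

theorem shiftedMu_theta_exchange (d : ℤ) (c e : Fin n) :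
    F.shiftedMu D (d + 1) c * F.theta c * (F.shiftedMu D d e * F.theta e) =
      F.shiftedMu D (d + 1) e * F.theta e * (F.shiftedMu D d c * F.theta c) ∧
    F.shiftedMu D (d + 1) c * F.theta c * (F.shiftedMu D d c * F.theta c) = 0 := by
  have hθ : ∀ c e, F.theta c * F.shiftedMu D d e = -(F.shiftedMu D d e * F.theta c) := by
    intro c e
    have h₁ : F.theta c * (d * (F.coef D.h * F.psi e)) =
        -(d * (F.coef D.h * F.psi e) * F.theta c) := by
      rw [← mul_assoc, ← (Int.cast_commute d _).eq, mul_assoc, ← mul_assoc (F.theta c),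
        ← (F.coef_theta _ c).eq, mul_assoc, F.theta_psi]
      noncomm_ring
    rw [shiftedMu, mul_add, F.theta_mu, h₁, add_mul, neg_add]
  have hmul : ∀ c e, F.shiftedMu D (d + 1) c * F.theta c * (F.shiftedMu D d e * F.theta e) =
      -(F.shiftedMu D (d + 1) c * F.shiftedMu D d e * (F.theta c * F.theta e)) := by
    intro c e
    rw [mul_assoc, ← mul_assoc (F.theta c), hθ]
    noncomm_ring
  constructor
  · rw [hmul, hmul, F.shiftedMu_mul D d c e, F.theta_theta c e]
    noncomm_ring
  · rw [hmul, F.theta_sq, mul_zero, neg_zero]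

theorem ev_cdet_eq (ev : E →+ A) (hdel₁ : ∀ u j, ev (F.del j * u) = 0)
    (hdel₂ : ∀ u j, ev (u * F.del j) = 0) (hZ : ∀ u j k, ev (u * F.coef (D.Z j k)) = 0)
    [IsAddTorsionFree A] (hn : Even n) (hpos : 0 < n) :
    ev (F.coef (cdet (Matrix.of fun a b : Fin n =>
        (D.X * (D.Y + D.Z)) a b + if a = b then ((n : ℤ) - 2 - (b : ℕ)) • D.h else 0)) *
      F.monomial id) = ev (F.coef (cdet (D.X * D.Y)) * F.monomial id) := by
  have hL : ((List.range n).map fun i : ℕ =>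
      F.opPhi D + F.opDelta D + ((n : E) - 2 - i) * F.opTau D).prod =
      n.factorial • (F.coef (cdet (Matrix.of fun a b : Fin n =>
        (D.X * (D.Y + D.Z)) a b + if a = b then ((n : ℤ) - 2 - (b : ℕ)) • D.h else 0)) *
      F.monomial id) := by
    have h₁ := list_prod_sum_univ
      (fun (c : Fin n) (i : ℕ) => F.shiftedMu D ((n : ℤ) - 2 - i) c * F.theta c)
      (fun c e i => ?_) (fun c i => ?_)
    · rw [← F.prod_lin_mul_theta]
      convert h₁ using 4 with i c
      · simp only [shiftedMu, add_mul, Finset.sum_add_distrib, F.sum_mu_mul_theta]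
        simp only [opTau, Finset.mul_sum, mul_assoc]
        push_cast
        rfl
      · funext c
        congr 1
        simp only [lin, shiftedMu, mu, Matrix.of_apply, map_add, add_mul, Finset.sum_add_distrib,
          apply_ite F.coef, map_zero, ite_mul, zero_mul, Finset.sum_ite_eq', Finset.mem_univ,
          if_true, map_zsmul]
        simp only [zsmul_eq_mul, mul_assoc]
    · have := (F.shiftedMu_theta_exchange D ((n : ℤ) - 2 - (i + 1 : ℕ)) c e).1
      rwa [show (n : ℤ) - 2 - (i + 1 : ℕ) + 1 = n - 2 - i by push_cast; ring] at this
    · have := (F.shiftedMu_theta_exchange D ((n : ℤ) - 2 - (i + 1 : ℕ)) c c).2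
      rwa [show (n : ℤ) - 2 - (i + 1 : ℕ) + 1 = n - 2 - i by push_cast; ring] at this
  have hR : F.opPhi D ^ n = n.factorial • (F.coef (cdet (D.X * D.Y)) * F.monomial id) := by
    have hXY : ∀ i j k l, Commute ((D.X * D.Y) i j) ((D.X * D.Y) k l) := by
      intro i j k l
      rw [Matrix.mul_apply, Matrix.mul_apply]
      exact Commute.sum_left _ _ _ fun _ _ => Commute.sum_right _ _ _ fun _ _ =>
        ((D.X_X _ _ _ _).mul_right (D.X_Y _ _ _ _)).mul_left
          ((D.X_Y _ _ _ _).symm.mul_right (D.Y_Y _ _ _ _))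
    have hθ : ∀ i j, F.theta i * F.lin F.psi (D.X * D.Y) j =
        -(F.lin F.psi (D.X * D.Y) j * F.theta i) := fun i j =>
      F.anticommute_lin (fun c => F.coef_theta c i) (F.theta_psi i) _ _
    have h₁ := list_prod_sum_univ
      (fun (c : Fin n) (_ : ℕ) => F.lin F.psi (D.X * D.Y) c * F.theta c)
      (fun c e _ => commute_mul_mul_of_anticommute
        (F.lin_anticommute_lin F.coef_psi F.coef_psi F.psi_psi hXY _ _)
        (neg_swap (hθ _ _)) (hθ _ _) (F.theta_theta _ _)) (fun c _ => by
        rw [mul_assoc, ← mul_assoc (F.theta c), hθ, neg_mul, mul_assoc, F.theta_sq]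
        simp)
    rw [F.sum_lin_psi_mul_theta] at h₁
    rw [← F.prod_lin_mul_theta, ← h₁, List.map_const', List.prod_replicate, List.length_range]
    rfl
  refine nsmul_right_injective (n := n.factorial) (Nat.factorial_ne_zero n) ?_
  simp only
  rw [← map_nsmul, ← map_nsmul, ← hL, ← hR]
  exact F.ev_prod_opPhi_eq D ev hdel₁ hdel₂ hZ hn hpos

end Fermions

/-! ### The Fock space model -/

section Fock

open TensorProduct

variable (k : Type*) [CommRing k] (n : ℕ)

/-- The exterior algebra on two families of generators. -/
abbrev Fock : Type _ := ExteriorAlgebra k (Fin n ⊕ Fin n → k)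

variable {n}

/-- Exterior multiplication by a generator. -/
def creation (s : Fin n ⊕ Fin n) : Module.End k (Fock k n) :=
  LinearMap.mulLeft k (ExteriorAlgebra.ι k (Pi.single s 1))

/-- Contraction against a generator. -/
def annihilation (s : Fin n ⊕ Fin n) : Module.End k (Fock k n) :=
  CliffordAlgebra.contractLeft (LinearMap.proj s)

theorem creation_creation (s t : Fin n ⊕ Fin n) :
    creation k s * creation k t = -(creation k t * creation k s) := by
  refine LinearMap.ext fun x => ?_
  have := ExteriorAlgebra.ι_add_mul_swap (R := k) (Pi.single s 1 : Fin n ⊕ Fin n → k)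
    (Pi.single t 1)
  simp only [creation, Module.End.mul_apply, LinearMap.mulLeft_apply, LinearMap.neg_apply,
    ← mul_assoc]
  rw [eq_neg_of_add_eq_zero_left this, neg_mul]

theorem creation_sq (s : Fin n ⊕ Fin n) : creation k s * creation k s = 0 := by
  refine LinearMap.ext fun x => ?_
  simp only [creation, Module.End.mul_apply, LinearMap.mulLeft_apply, LinearMap.zero_apply,
    ← mul_assoc]
  rw [ExteriorAlgebra.ι_sq_zero, zero_mul]

theorem annihilation_annihilation (s t : Fin n ⊕ Fin n) :
    annihilation k s * annihilation k t = -(annihilation k t * annihilation k s) :=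
  LinearMap.ext fun x => CliffordAlgebra.contractLeft_comm _ _ x

theorem annihilation_sq (s : Fin n ⊕ Fin n) : annihilation k s * annihilation k s = 0 :=
  LinearMap.ext fun x => CliffordAlgebra.contractLeft_contractLeft _ x

theorem annihilation_creation (s t : Fin n ⊕ Fin n) : annihilation k s * creation k t =
    (if s = t then 1 else 0) - creation k t * annihilation k s := by
  refine LinearMap.ext fun x => ?_
  refine (CliffordAlgebra.contractLeft_ι_mul _ _ _).trans ?_
  rw [LinearMap.sub_apply]
  congr 1
  by_cases h : s = t
  · subst h
    simp
  · simp [h]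

theorem annihilation_creation_of_ne {s t : Fin n ⊕ Fin n} (h : s ≠ t) :
    annihilation k s * creation k t = -(creation k t * annihilation k s) := by
  rw [annihilation_creation, if_neg h, zero_sub]

theorem annihilation_one (s : Fin n ⊕ Fin n) : annihilation k s 1 = 0 :=
  CliffordAlgebra.contractLeft_one _ _

/-- Creation of the pair of generators with index `c`. -/
def pairCreation (c : Fin n) : Module.End k (Fock k n) :=
  creation k (Sum.inl c) * creation k (Sum.inr c)

/-- Annihilation of the pair of generators with index `c`. -/
def pairAnnihilation (c : Fin n) : Module.End k (Fock k n) :=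
  annihilation k (Sum.inr c) * annihilation k (Sum.inl c)

theorem pairAnnihilation_pairCreation_one (c : Fin n) :
    pairAnnihilation k c (pairCreation k c 1) = 1 := by
  have h₁ := LinearMap.congr_fun (annihilation_creation k (Sum.inl c) (Sum.inl c))
    (creation k (Sum.inr c) 1)
  have h₂ := LinearMap.congr_fun
    (annihilation_creation_of_ne k (s := Sum.inl c) (t := Sum.inr c) (by simp)) 1
  have h₃ := LinearMap.congr_fun (annihilation_creation k (Sum.inr c) (Sum.inr c)) 1
  simp only [Module.End.mul_apply, LinearMap.sub_apply, LinearMap.neg_apply, annihilation_one,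
    if_true, Module.End.one_apply, map_zero, neg_zero, sub_zero] at h₁ h₂ h₃
  rw [pairAnnihilation, pairCreation, Module.End.mul_apply, Module.End.mul_apply, h₁, h₂,
    map_zero, sub_zero, h₃]

theorem pairAnnihilation_commute_pairCreation {c d : Fin n} (h : c ≠ d) :
    Commute (pairAnnihilation k c) (pairCreation k d) :=
  commute_mul_mul_of_anticommute (annihilation_creation_of_ne k (by simp))
    (annihilation_creation_of_ne k (by simpa using h))
    (annihilation_creation_of_ne k (by simpa using h)) (annihilation_creation_of_ne k (by simp))

theorem pairAnnihilation_commute_annihilation (c : Fin n) (s : Fin n ⊕ Fin n) :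
    Commute (pairAnnihilation k c) (annihilation k s) :=
  commute_mul_of_anticommute (annihilation_annihilation k _ s) (annihilation_annihilation k _ s)

theorem pairAnnihilation_mul_annihilation (c : Fin n) :
    pairAnnihilation k c * annihilation k (Sum.inr c) = 0 := by
  rw [(pairAnnihilation_commute_annihilation k c _).eq, pairAnnihilation, ← mul_assoc,
    annihilation_sq, zero_mul]

theorem prod_pairAnnihilation_mul_annihilation {j : Fin n} {l : List (Fin n)} (hj : j ∈ l) :
    (l.map (pairAnnihilation k)).prod * annihilation k (Sum.inr j) = 0 := by
  induction l with
  | nil => simp at hj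
  | cons c l ih =>
    rw [List.map_cons, List.prod_cons, mul_assoc]
    by_cases h : j ∈ l
    · rw [ih h, mul_zero]
    · obtain rfl : j = c := by simpa [h] using hj
      have : Commute (l.map (pairAnnihilation k)).prod (annihilation k (Sum.inr j)) :=
        Commute.list_prod_left _ _ fun x hx => by
          obtain ⟨d, -, rfl⟩ := List.mem_map.1 hx
          exact pairAnnihilation_commute_annihilation k d _
      rw [this.eq, ← mul_assoc, pairAnnihilation_mul_annihilation, zero_mul]

theorem prod_pairAnnihilation_prod_pairCreation {l : List (Fin n)} (hl : l.Nodup) :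
    (l.map (pairAnnihilation k)).prod ((l.map (pairCreation k)).prod 1) = 1 := by
  induction l with
  | nil => rfl
  | cons c l ih =>
    rw [List.nodup_cons] at hl
    have : Commute (l.map (pairAnnihilation k)).prod (pairCreation k c) :=
      Commute.list_prod_left _ _ fun x hx => by
        obtain ⟨d, hd, rfl⟩ := List.mem_map.1 hx
        exact pairAnnihilation_commute_pairCreation k fun h => hl.1 (h ▸ hd)
    rw [List.map_cons, List.prod_cons, List.map_cons, List.prod_cons, ← Module.End.mul_apply,
      mul_assoc, ← mul_assoc _ (pairCreation k c), this.eq, mul_assoc, Module.End.mul_apply,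
      Module.End.mul_apply, Module.End.mul_apply, ih hl.2, pairAnnihilation_pairCreation_one]

variable (n) (A : Type*) [AddCommGroup A] [Module k A]

/-- Fermions acting on the Fock space with coefficients in a module. -/
def fockFermions : Fermions (Module.End k A) (Module.End k (A ⊗[k] Fock k n)) n :=
  let L := Module.End.lTensorAlgHom k (Fock k n) A
  let coef := Module.End.rTensorAlgHom k A (Fock k n)
  have hL : ∀ c x, Commute (coef c) (L x) := fun c x => by
    rw [commute_iff_eq]
    exact (LinearMap.rTensor_comp_lTensor ..).trans (LinearMap.lTensor_comp_rTensor ..).symm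
  have hneg : ∀ {x y : Module.End k (Fock k n)}, x * y = -(y * x) →
      L x * L y = -(L y * L x) := fun h => by
    rw [← map_mul, h, map_neg, map_mul]
  { coef := coef
    psi := fun a => L (creation k (Sum.inl a))
    theta := fun a => L (creation k (Sum.inr a))
    del := fun a => L (annihilation k (Sum.inr a))
    coef_psi := fun _ _ => hL _ _
    coef_theta := fun _ _ => hL _ _
    coef_del := fun _ _ => hL _ _
    psi_psi := fun _ _ => hneg (creation_creation k _ _)
    theta_theta := fun _ _ => hneg (creation_creation k _ _)
    theta_sq := fun a => by rw [← map_mul, creation_sq, map_zero]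
    psi_sq := fun a => by rw [← map_mul, creation_sq, map_zero]
    theta_psi := fun _ _ => hneg (creation_creation k _ _)
    del_psi := fun _ _ => hneg (annihilation_creation_of_ne k (by simp))
    del_theta := fun a b => by
      rw [← map_mul, annihilation_creation, map_sub, map_mul, apply_ite L, map_one, map_zero]
      simp }

/-- The top-degree coefficient of the value of an operator at a vacuum vector. -/
def topCoeff (a : A) : Module.End k (A ⊗[k] Fock k n) →+ A :=
  ((TensorProduct.rid k A).toLinearMap ∘ₗ LinearMap.lTensor A
    (ExteriorAlgebra.algebraMapInv.toLinearMap ∘ₗ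
      ((List.finRange n).map (pairAnnihilation k)).prod)).toAddMonoidHom.comp
    (LinearMap.applyₗ (R := k) (a ⊗ₜ[k] (1 : Fock k n))).toAddMonoidHom

theorem topCoeff_apply (a : A) (u : Module.End k (A ⊗[k] Fock k n)) : topCoeff k n A a u =
    TensorProduct.rid k A (LinearMap.lTensor A
      (ExteriorAlgebra.algebraMapInv.toLinearMap ∘ₗ
        ((List.finRange n).map (pairAnnihilation k)).prod) (u (a ⊗ₜ[k] 1))) := rfl

theorem topCoeff_del_mul (a : A) (u : Module.End k (A ⊗[k] Fock k n)) (j : Fin n) :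
    topCoeff k n A a ((fockFermions k n A).del j * u) = 0 := by
  have h : (ExteriorAlgebra.algebraMapInv.toLinearMap ∘ₗ
      ((List.finRange n).map (pairAnnihilation k)).prod) ∘ₗ annihilation k (Sum.inr j) = 0 := by
    rw [LinearMap.comp_assoc]
    exact (congrArg _ (prod_pairAnnihilation_mul_annihilation k (List.mem_finRange j))).trans
      (LinearMap.comp_zero _)
  rw [topCoeff_apply, Module.End.mul_apply]
  change TensorProduct.rid k A (LinearMap.lTensor A _ (LinearMap.lTensor A _ _)) = 0
  rw [← LinearMap.lTensor_comp_apply, h, LinearMap.lTensor_zero, LinearMap.zero_apply, map_zero]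

theorem topCoeff_mul_del (a : A) (u : Module.End k (A ⊗[k] Fock k n)) (j : Fin n) :
    topCoeff k n A a (u * (fockFermions k n A).del j) = 0 := by
  have h : (fockFermions k n A).del j (a ⊗ₜ[k] 1) = 0 :=
    (LinearMap.lTensor_tmul _ _ _ _).trans (by rw [annihilation_one, tmul_zero])
  rw [topCoeff_apply, Module.End.mul_apply, h, map_zero, map_zero, map_zero]

theorem topCoeff_mul_coef (a : A) (u : Module.End k (A ⊗[k] Fock k n)) {f : Module.End k A}
    (hf : f a = 0) : topCoeff k n A a (u * (fockFermions k n A).coef f) = 0 := by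
  have h : (fockFermions k n A).coef f (a ⊗ₜ[k] 1) = 0 :=
    (LinearMap.rTensor_tmul _ _ _ _).trans (by rw [hf, zero_tmul])
  rw [topCoeff_apply, Module.End.mul_apply, h, map_zero, map_zero, map_zero]

theorem topCoeff_coef_mul_monomial (a : A) (f : Module.End k A) :
    topCoeff k n A a ((fockFermions k n A).coef f * (fockFermions k n A).monomial id) = f a := by
  have h : (fockFermions k n A).monomial id = Module.End.lTensorAlgHom k (Fock k n) A
      ((List.finRange n).map (pairCreation k)).prod := by
    rw [map_list_prod, List.map_map]
    refine congrArg List.prod (List.map_congr_left fun c _ => ?_)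
    exact (map_mul _ _ _).symm
  have h₁ : ((fockFermions k n A).coef f * (fockFermions k n A).monomial id) (a ⊗ₜ[k] 1) =
      f a ⊗ₜ[k] ((List.finRange n).map (pairCreation k)).prod 1 := by
    rw [h]; rfl
  rw [topCoeff_apply, h₁, LinearMap.lTensor_tmul, LinearMap.comp_apply,
    prod_pairAnnihilation_prod_pairCreation k (List.nodup_finRange n)]
  simp

end Fock

/-! ### The pair of matrices acting by multiplication operators -/

section Multiplication

variable (k : Type*) [CommRing k] {A : Type*} [Ring A] [Algebra k A] {n : ℕ}

/-- Left multiplication by `X` together with right multiplication by `Y`. -/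
def mulCapelliData (X Y : Matrix (Fin n) (Fin n) A) (h : A)
    (hX : ∀ i j k l, Commute (X i j) (X k l)) (hY : ∀ i j k l, Commute (Y i j) (Y k l))
    (hYanti : ∀ k l, Y k l = -Y l k)
    (hhX : ∀ i j, Commute h (X i j)) (hhY : ∀ i j, Commute h (Y i j))
    (hXY : ∀ i j k l, X i j * Y k l - Y k l * X i j
        = -((if j = k ∧ i = l then h else 0) - (if i = k ∧ j = l then h else 0))) :
    CapelliData (Module.End k A) n :=
  let L := Algebra.lmul k A
  have hL : ∀ {a b : A}, Commute a b → Commute (L a) (L b) := fun hab => hab.map L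
  have hR : ∀ {a b : A}, Commute a b →
      Commute (LinearMap.mulRight k a) (LinearMap.mulRight k b) := fun {a b} hab =>
    LinearMap.ext fun x => by simp [mul_assoc, hab.eq]
  have hLR : ∀ a b : A, Commute (L a) (LinearMap.mulRight k b) :=
    fun a b => LinearMap.commute_mulLeft_right a b
  { X := X.map L
    Y := Y.map (LinearMap.mulRight k)
    Z := Y.map fun y => L y - LinearMap.mulRight k y
    h := L h
    X_X := fun _ _ _ _ => hL (hX _ _ _ _)
    Y_Y := fun _ _ _ _ => hR (hY _ _ _ _)
    X_Y := fun _ _ _ _ => hLR _ _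
    Y_Z := fun _ _ _ _ => ((hLR _ _).symm).sub_right (hR (hY _ _ _ _))
    Z_Z := fun _ _ _ _ => ((hL (hY _ _ _ _)).sub_right (hLR _ _)).sub_left
      ((hLR _ _).symm.sub_right (hR (hY _ _ _ _)))
    h_X := fun _ _ => hL (hhX _ _)
    h_Y := fun _ _ => hLR _ _
    h_Z := fun _ _ => (hL (hhY _ _)).sub_right (hLR _ _)
    Y_anti := fun i j => by
      refine LinearMap.ext fun x => ?_
      simp [hYanti i j]
    Z_anti := fun i j => by
      refine LinearMap.ext fun x => ?_
      simp only [Matrix.map_apply, hYanti i j, map_neg]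
      simp [neg_add_eq_sub]
    Z_X := fun i j p q => by
      have h₁ := congrArg L (hXY i j p q)
      simp only [map_sub, map_mul, map_neg, apply_ite L, map_zero] at h₁
      have h₂ := (hLR (X i j) (Y p q)).eq
      simp only [Matrix.map_apply, sub_mul, mul_sub, ← h₂]
      rw [← sub_eq_iff_eq_add', sub_sub_sub_cancel_right, ← neg_sub, h₁, neg_neg] }

theorem list_prod_map_mulRight_apply_one {l : List A} (hl : ∀ a ∈ l, ∀ b ∈ l, Commute a b) :
    (l.map (LinearMap.mulRight k)).prod 1 = l.prod := by
  induction l with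
  | nil => rfl
  | cons a l ih =>
    rw [List.map_cons, List.prod_cons, Module.End.mul_apply,
      ih fun b hb c hc => hl b (List.mem_cons_of_mem _ hb) c (List.mem_cons_of_mem _ hc),
      LinearMap.mulRight_apply, List.prod_cons]
    exact (Commute.list_prod_right _ _ fun b hb =>
      hl a List.mem_cons_self b (List.mem_cons_of_mem _ hb)).eq.symm

theorem cdet_map_mulRight_apply_one {Y : Matrix (Fin n) (Fin n) A}
    (hY : ∀ i j k l, Commute (Y i j) (Y k l)) :
    cdet (Y.map (LinearMap.mulRight k)) 1 = cdet Y := by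
  simp only [cdet, LinearMap.sum_apply, LinearMap.smul_apply, Matrix.map_apply]
  refine Finset.sum_congr rfl fun σ _ => congrArg _ ?_
  have hcomm : ∀ a ∈ (List.finRange n).map fun t => Y (σ t) t,
      ∀ b ∈ (List.finRange n).map fun t => Y (σ t) t, Commute a b := by
    intro a ha b hb
    obtain ⟨i, -, rfl⟩ := List.mem_map.1 ha
    obtain ⟨j, -, rfl⟩ := List.mem_map.1 hb
    exact hY _ _ _ _
  have := list_prod_map_mulRight_apply_one k hcomm
  rwa [List.map_map] at this

end Multiplication

theorem huks_even
    {A : Type*} [Ring A] [Algebra ℂ A] (n : ℕ) (hn : Even n) (hpos : 0 < n)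
    (X Y : Matrix (Fin n) (Fin n) A)
    (hXcomm : ∀ i j k l, Commute (X i j) (X k l))
    (hYcomm : ∀ i j k l, Commute (Y i j) (Y k l))
    (hYanti : ∀ k l, Y k l = - Y l k)
    (h : A)
    (hhX : ∀ i j, Commute h (X i j)) (hhY : ∀ i j, Commute h (Y i j))
    (hXY : ∀ i j k l, X i j * Y k l - Y k l * X i j
        = -((if j = k ∧ i = l then h else 0) - (if i = k ∧ j = l then h else 0))) :
    cdet (Matrix.of fun a b : Fin n =>
        (X * Y) a b + if a = b then ((n : ℤ) - 2 - (b : ℕ)) • h else 0)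
      = cdet X * cdet Y := by
  let D := mulCapelliData ℂ X Y h hXcomm hYcomm hYanti hhX hhY hXY
  have : IsAddTorsionFree A := ⟨fun m hm a b hab => by
    simpa [← Nat.cast_smul_eq_nsmul ℂ, hm] using hab⟩
  have key := (fockFermions ℂ n A).ev_cdet_eq D (topCoeff ℂ n A 1)
    (topCoeff_del_mul ℂ n A 1) (topCoeff_mul_del ℂ n A 1)
    (fun u j k => topCoeff_mul_coef ℂ n A 1 u <| by
      simp [D, mulCapelliData]) hn hpos
  rw [topCoeff_coef_mul_monomial, topCoeff_coef_mul_monomial,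
    cdet_mul_of_commute D.X_X D.Y_Y D.X_Y, Module.End.mul_apply] at key
  have hXL : cdet D.X = Algebra.lmul ℂ A (cdet X) :=
    (map_cdet (Algebra.lmul ℂ A).toRingHom X).symm
  have hYR : cdet D.Y 1 = cdet Y := cdet_map_mulRight_apply_one ℂ hYcomm
  have hsum : D.Y + D.Z = Y.map (Algebra.lmul ℂ A) :=
    Matrix.ext fun _ _ => add_sub_cancel _ _
  rw [hYR, hXL, hsum] at key
  refine Eq.trans ?_ key
  refine (mul_one _).symm.trans (LinearMap.congr_fun (f := Algebra.lmul ℂ A _) ?_ 1)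
  refine (map_cdet (Algebra.lmul ℂ A).toRingHom _).trans (congrArg cdet (Matrix.ext fun a b => ?_))
  have hmul : X.map (Algebra.lmul ℂ A) * Y.map (Algebra.lmul ℂ A) =
      (X * Y).map (Algebra.lmul ℂ A) := Matrix.map_mul.symm
  change Algebra.lmul ℂ A ((X * Y) a b + _) =
    (X.map (Algebra.lmul ℂ A) * Y.map (Algebra.lmul ℂ A)) a b + _
  rw [hmul, map_add, apply_ite (Algebra.lmul ℂ A), map_zsmul, map_zero]
  rfl

end Stmt8
end

section
/- Let n be an odd positive integer, A a unital associative ℂ-algebra, X and Y n×n matrices over A such that the entries of X pairwise commute and the entries of Y pairwise commute, at least one of X, Y is antisymmetric, and there is h ∈ A commuting with every entry of X and of Y with [X_{ij}, Y_{kl}] = −h(δ_{jk}δ_{il} − δ_{ik}δ_{jl}) for all 1 ≤ i,j,k,l ≤ n. Then cdet(XY + h·diag(n−1, n−2, …, 1, 0)) = cdet(X) · cdet(Y) = 0; that is, the matrix with (a,b)-entry Σ_j X_{aj}Y_{jb} + δ_{ab}(n−b)h has column determinant equal to cdet(X)·cdet(Y), and this common value is 0. -/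
/-!
STATEMENT 9: Howe–Umeda–Kostant–Sahi type identity, odd case:
cdet(XY + h·diag(n−1, …, 1, 0)) = cdet(X)·cdet(Y) = 0.
-/

namespace Stmt9

open Matrix

/-- The column determinant `cdet(M) = Σ_σ sgn(σ) M_{σ(1),1} ⋯ M_{σ(n),n}` of a square
matrix over a possibly noncommutative ring, product taken in the displayed order. -/
def cdet {A : Type*} [Ring A] {n : ℕ} (M : Matrix (Fin n) (Fin n) A) : A :=
  ∑ σ : Equiv.Perm (Fin n),
    (Equiv.Perm.sign σ : ℤ) • ((List.finRange n).map (fun t => M (σ t) t)).prod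

/-- Commutation relations among the entries of `X` and `Y` and the central parameter `h`. -/
structure CapelliPair {T : Type*} [Ring T] {n : ℕ} (X Y : Fin n → Fin n → T) (h : T) : Prop where
  X_comm : ∀ i j k l, X i j * X k l = X k l * X i j
  Y_comm : ∀ i j k l, Y i j * Y k l = Y k l * Y i j
  h_X : ∀ i j, h * X i j = X i j * h
  h_Y : ∀ i j, h * Y i j = Y i j * h
  X_Y : ∀ i j k l, X i j * Y k l - Y k l * X i j
    = -((if j = k ∧ i = l then h else 0) - (if i = k ∧ j = l then h else 0))

/-- A `CapelliPair` together with a family `ψ` of anticommuting elements which commute with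
`X`, `Y` and `h`. -/
structure CapelliSystem {T : Type*} [Ring T] {n : ℕ} (X Y : Fin n → Fin n → T) (h : T)
    (ψ : Fin n → T) : Prop extends CapelliPair X Y h where
  X_psi : ∀ i j a, X i j * ψ a = ψ a * X i j
  Y_psi : ∀ i j a, Y i j * ψ a = ψ a * Y i j
  h_psi : ∀ a, h * ψ a = ψ a * h
  psi_psi : ∀ a b, ψ a * ψ b = -(ψ b * ψ a)

namespace CapelliSystem

variable {T : Type*} [Ring T] {n : ℕ}

/-- The anticommuting combination `ξ_j = ∑ a, ψ_a X_{aj}`. -/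
def xi (X : Fin n → Fin n → T) (ψ : Fin n → T) (j : Fin n) : T := ∑ a, ψ a * X a j

/-- The quadratic element `Ω = ∑ k, ξ_k ψ_k`. -/
def om (X : Fin n → Fin n → T) (ψ : Fin n → T) : T := ∑ k, xi X ψ k * ψ k

/-- The generating element `η_b = ∑ j, ξ_j Y_{jb}` of the `b`-th column of `XY`. -/
def eta (X Y : Fin n → Fin n → T) (ψ : Fin n → T) (b : Fin n) : T := ∑ j, xi X ψ j * Y j b

/-- The generating element of the `b`-th column of `XY`, shifted by `m h` on the diagonal. -/
def col (X Y : Fin n → Fin n → T) (h : T) (ψ : Fin n → T) (m : ℕ) (b : Fin n) : T :=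
  eta X Y ψ b + m • (h * ψ b)

/-- The product of the columns listed in `L`, shifted by the number of columns on their right. -/
def colProd (X Y : Fin n → Fin n → T) (h : T) (ψ : Fin n → T) : List (Fin n) → T
  | [] => 1
  | b :: L => col X Y h ψ L.length b * colProd X Y h ψ L

variable {X Y : Fin n → Fin n → T} {h : T} {ψ : Fin n → T}

theorem X_xi (S : CapelliSystem X Y h ψ) (i j k) : X i j * xi X ψ k = xi X ψ k * X i j := by
  simp only [xi, Finset.mul_sum, Finset.sum_mul]
  refine Finset.sum_congr rfl fun a _ => ?_
  rw [← mul_assoc, S.X_psi, mul_assoc, S.X_comm, mul_assoc]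

theorem h_xi (S : CapelliSystem X Y h ψ) (k) : h * xi X ψ k = xi X ψ k * h := by
  simp only [xi, Finset.mul_sum, Finset.sum_mul]
  refine Finset.sum_congr rfl fun a _ => ?_
  rw [← mul_assoc, S.h_psi, mul_assoc, S.h_X, mul_assoc]

theorem psi_xi (S : CapelliSystem X Y h ψ) (b k) : ψ b * xi X ψ k = -(xi X ψ k * ψ b) := by
  simp only [xi, Finset.mul_sum, Finset.sum_mul, ← Finset.sum_neg_distrib]
  refine Finset.sum_congr rfl fun a _ => ?_
  rw [← mul_assoc, S.psi_psi, mul_assoc, S.X_psi, neg_mul, mul_assoc]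

theorem xi_xi (S : CapelliSystem X Y h ψ) (j k) :
    xi X ψ j * xi X ψ k = -(xi X ψ k * xi X ψ j) := by
  conv_lhs => rw [xi]
  conv_rhs => rw [xi.eq_def X ψ j]
  simp only [Finset.mul_sum, Finset.sum_mul, ← Finset.sum_neg_distrib]
  refine Finset.sum_congr rfl fun a _ => ?_
  rw [mul_assoc, S.X_xi, ← mul_assoc, S.psi_xi, ← mul_assoc, neg_mul]

theorem xi_om (S : CapelliSystem X Y h ψ) (j) : xi X ψ j * om X ψ = om X ψ * xi X ψ j := by
  simp only [om, Finset.mul_sum, Finset.sum_mul]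
  refine Finset.sum_congr rfl fun a _ => ?_
  rw [← mul_assoc, S.xi_xi, mul_assoc, S.psi_xi, neg_mul, mul_neg, mul_assoc]

theorem psi_om (S : CapelliSystem X Y h ψ) (b) : ψ b * om X ψ = om X ψ * ψ b := by
  simp only [om, Finset.mul_sum, Finset.sum_mul]
  refine Finset.sum_congr rfl fun a _ => ?_
  rw [← mul_assoc, S.psi_xi, neg_mul, mul_assoc, S.psi_psi b a, mul_neg, neg_neg, mul_assoc]

theorem h_om (S : CapelliSystem X Y h ψ) : h * om X ψ = om X ψ * h := by
  simp only [om, Finset.mul_sum, Finset.sum_mul]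
  refine Finset.sum_congr rfl fun a _ => ?_
  rw [← mul_assoc, S.h_xi, mul_assoc, S.h_psi, mul_assoc]

theorem h_eta (S : CapelliSystem X Y h ψ) (b) : h * eta X Y ψ b = eta X Y ψ b * h := by
  simp only [eta, Finset.mul_sum, Finset.sum_mul]
  refine Finset.sum_congr rfl fun a _ => ?_
  rw [← mul_assoc, S.h_xi, mul_assoc, S.h_Y, mul_assoc]

theorem eta_psi (S : CapelliSystem X Y h ψ) (b c) :
    eta X Y ψ b * ψ c = -(ψ c * eta X Y ψ b) := by
  simp only [eta, Finset.mul_sum, Finset.sum_mul, ← Finset.sum_neg_distrib]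
  refine Finset.sum_congr rfl fun a _ => ?_
  rw [mul_assoc, S.Y_psi, ← mul_assoc, ← mul_assoc, S.psi_xi, neg_mul, neg_neg]

theorem Y_xi (S : CapelliSystem X Y h ψ) (k b j) : Y k b * xi X ψ j
    = xi X ψ j * Y k b + (if j = k then h * ψ b else 0) - (if j = b then h * ψ k else 0) := by
  have key : ∀ a, Y k b * (ψ a * X a j) = ψ a * X a j * Y k b
      + (if j = k ∧ a = b then h * ψ a else 0) - (if a = k ∧ j = b then h * ψ a else 0) := by
    intro a
    have e := S.X_Y a j k b
    have e' : Y k b * X a j = X a j * Y k b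
        + ((if j = k ∧ a = b then h else 0) - (if a = k ∧ j = b then h else 0)) := by
      rw [sub_eq_iff_eq_add] at e
      rw [e]; abel
    rw [← mul_assoc, S.Y_psi, mul_assoc, e', S.h_psi]
    simp only [mul_add, mul_sub, mul_ite, mul_zero, mul_assoc]
    abel
  simp only [xi, Finset.mul_sum, Finset.sum_mul, key, Finset.sum_add_distrib,
    Finset.sum_sub_distrib]
  congr 2
  · by_cases hjk : j = k <;> simp [hjk]
  · by_cases hjb : j = b <;> simp [hjb]

theorem eta_xi (S : CapelliSystem X Y h ψ) (b j) : eta X Y ψ b * xi X ψ j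
    = -(xi X ψ j * eta X Y ψ b) + h * (xi X ψ j * ψ b) - (if j = b then h * om X ψ else 0) := by
  have key : ∀ k, xi X ψ k * Y k b * xi X ψ j = -(xi X ψ j * (xi X ψ k * Y k b))
      + (if j = k then h * (xi X ψ k * ψ b) else 0)
      - (if j = b then h * (xi X ψ k * ψ k) else 0) := by
    intro k
    rw [mul_assoc, S.Y_xi]
    simp only [mul_add, mul_sub, mul_ite, mul_zero, ← mul_assoc]
    rw [S.xi_xi k j, ← S.h_xi, neg_mul]
  simp only [eta, om, Finset.mul_sum, Finset.sum_mul, key, Finset.sum_add_distrib,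
    Finset.sum_sub_distrib, Finset.sum_neg_distrib]
  congr 2
  · simp
  · by_cases hjb : j = b <;> simp [hjb]

theorem eta_om (S : CapelliSystem X Y h ψ) (b) : eta X Y ψ b * om X ψ
    = om X ψ * eta X Y ψ b - 2 • (h * (ψ b * om X ψ)) := by
  have key : ∀ k, eta X Y ψ b * (xi X ψ k * ψ k) = xi X ψ k * ψ k * eta X Y ψ b
      - h * (xi X ψ k * ψ k * ψ b) - (if k = b then h * (om X ψ * ψ k) else 0) := by
    intro k
    rw [← mul_assoc, S.eta_xi, sub_mul, add_mul, neg_mul, mul_assoc (xi X ψ k), S.eta_psi,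
      mul_assoc h, mul_assoc (xi X ψ k) (ψ b), S.psi_psi b k]
    split_ifs <;> simp only [mul_neg, mul_assoc, neg_neg, zero_mul] <;> abel
  conv_lhs => rw [om]
  simp only [Finset.mul_sum, key, Finset.sum_sub_distrib, ← Finset.sum_mul]
  rw [Finset.sum_ite_eq' Finset.univ b, if_pos (Finset.mem_univ _), ← Finset.mul_sum,
    ← Finset.sum_mul, ← om, S.psi_om]
  abel

theorem col_xi (S : CapelliSystem X Y h ψ) (m b j) : col X Y h ψ (m + 1) b * xi X ψ j
    = -(xi X ψ j * col X Y h ψ m b) - (if j = b then om X ψ * h else 0) := by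
  simp only [col, add_mul, mul_add, S.eta_xi, smul_mul_assoc, mul_smul_comm, mul_assoc, S.psi_xi,
    S.h_om, add_smul, one_smul]
  rw [← mul_assoc (xi X ψ j) h, ← S.h_xi, mul_assoc]
  simp only [mul_neg, smul_neg]
  abel

theorem col_om (S : CapelliSystem X Y h ψ) (m b) : col X Y h ψ (m + 2) b * om X ψ
    = om X ψ * col X Y h ψ m b := by
  simp only [col, add_mul, mul_add, S.eta_om, smul_mul_assoc, mul_smul_comm, mul_assoc,
    add_smul]
  rw [← mul_assoc (om X ψ) h, ← S.h_om, mul_assoc, S.psi_om]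
  abel

/-- The additive span of the elements `ξ_{j₁} ⋯ ξ_{jₖ} Ω^r t` with `k + 2 r = m`. -/
def normalSpan (X : Fin n → Fin n → T) (ψ : Fin n → T) (m : ℕ) : AddSubgroup T :=
  AddSubgroup.closure {w | ∃ (J : List (Fin n)) (r : ℕ) (t : T), J.length + 2 * r = m ∧
    w = (J.map (xi X ψ)).prod * om X ψ ^ r * t}

theorem xi_mul_mem_normalSpan {m : ℕ} {w : T} (j : Fin n) (hw : w ∈ normalSpan X ψ m) :
    xi X ψ j * w ∈ normalSpan X ψ (m + 1) := by
  induction hw using AddSubgroup.closure_induction with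
  | mem w hw =>
    obtain ⟨J, r, t, hJ, rfl⟩ := hw
    exact AddSubgroup.subset_closure
      ⟨j :: J, r, t, by simp; omega, by simp [mul_assoc]⟩
  | zero => simp
  | add u v _ _ hu hv => rw [mul_add]; exact add_mem hu hv
  | neg u _ hu => rw [mul_neg]; exact neg_mem hu

theorem om_mul_mem_normalSpan (S : CapelliSystem X Y h ψ) {m : ℕ} {w : T}
    (hw : w ∈ normalSpan X ψ m) : om X ψ * w ∈ normalSpan X ψ (m + 2) := by
  induction hw using AddSubgroup.closure_induction with
  | mem w hw =>
    obtain ⟨J, r, t, hJ, rfl⟩ := hw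
    refine AddSubgroup.subset_closure ⟨J, r + 1, t, by omega, ?_⟩
    have : Commute (om X ψ) (J.map (xi X ψ)).prod := by
      refine Commute.list_prod_right _ _ fun y hy => ?_
      obtain ⟨j, -, rfl⟩ := List.mem_map.1 hy
      exact (S.xi_om j).symm
    rw [← mul_assoc, ← mul_assoc, this.eq, pow_succ', ← mul_assoc]
  | zero => simp
  | add u v _ _ hu hv => rw [mul_add]; exact add_mem hu hv
  | neg u _ hu => rw [mul_neg]; exact neg_mem hu

theorem col_mul_om_pow_mem_normalSpan (S : CapelliSystem X Y h ψ) (b : Fin n) (t : T) (r : ℕ) :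
    col X Y h ψ (2 * r) b * (om X ψ ^ r * t) ∈ normalSpan X ψ (2 * r + 1) := by
  induction r with
  | zero =>
    simp only [col, eta, Finset.sum_mul, mul_zero, zero_smul, add_zero, pow_zero, one_mul]
    exact sum_mem fun j _ => AddSubgroup.subset_closure ⟨[j], 0, Y j b * t, by simp,
      by simp [mul_assoc]⟩
  | succ r ih =>
    rw [pow_succ', ← mul_assoc, ← mul_assoc, mul_add, mul_one, S.col_om, mul_assoc, mul_assoc]
    exact S.om_mul_mem_normalSpan ih

theorem h_mul_mem_normalSpan (S : CapelliSystem X Y h ψ) {m : ℕ} {w : T}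
    (hw : w ∈ normalSpan X ψ m) : h * w ∈ normalSpan X ψ m := by
  induction hw using AddSubgroup.closure_induction with
  | mem w hw =>
    obtain ⟨J, r, t, hJ, rfl⟩ := hw
    refine AddSubgroup.subset_closure ⟨J, r, h * t, hJ, ?_⟩
    have : Commute h ((J.map (xi X ψ)).prod * om X ψ ^ r) := by
      refine Commute.mul_right (Commute.list_prod_right _ _ fun y hy => ?_)
        (Commute.pow_right S.h_om _)
      obtain ⟨j, -, rfl⟩ := List.mem_map.1 hy
      exact S.h_xi j
    rw [← mul_assoc, this.eq, mul_assoc]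
  | zero => simp
  | add u v _ _ hu hv => rw [mul_add]; exact add_mem hu hv
  | neg u _ hu => rw [mul_neg]; exact neg_mem hu

theorem col_mul_mem_normalSpan (S : CapelliSystem X Y h ψ) (b : Fin n) {m : ℕ} {w : T}
    (hw : w ∈ normalSpan X ψ m) : col X Y h ψ m b * w ∈ normalSpan X ψ (m + 1) := by
  induction hw using AddSubgroup.closure_induction with
  | mem w hw =>
    obtain ⟨J, r, t, rfl, rfl⟩ := hw
    induction J with
    | nil => simpa [mul_assoc] using S.col_mul_om_pow_mem_normalSpan b t r
    | cons j J ih =>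
      have e : (j :: J).length + 2 * r = J.length + 2 * r + 1 := by simp; omega
      have hmem : (J.map (xi X ψ)).prod * om X ψ ^ r * t ∈ normalSpan X ψ (J.length + 2 * r) :=
        AddSubgroup.subset_closure ⟨J, r, t, rfl, rfl⟩
      rw [e, List.map_cons, List.prod_cons, mul_assoc, mul_assoc, ← mul_assoc (col _ _ _ _ _ _),
        S.col_xi, ← mul_assoc (List.prod _), sub_mul, neg_mul, mul_assoc]
      refine sub_mem (neg_mem (xi_mul_mem_normalSpan j ih)) ?_
      split_ifs
      · rw [mul_assoc]
        exact S.om_mul_mem_normalSpan (S.h_mul_mem_normalSpan hmem)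
      · simp
  | zero => simp
  | add u v _ _ hu hv => rw [mul_add]; exact add_mem hu hv
  | neg u _ hu => rw [mul_neg]; exact neg_mem hu

theorem colProd_mem_normalSpan (S : CapelliSystem X Y h ψ) (L : List (Fin n)) :
    colProd X Y h ψ L ∈ normalSpan X ψ L.length := by
  induction L with
  | nil => exact AddSubgroup.subset_closure ⟨[], 0, 1, by simp, by simp [colProd]⟩
  | cons b L ih => exact S.col_mul_mem_normalSpan b ih

theorem eta_mul_eta_add (S : CapelliSystem X Y h ψ) (hY : ∀ k l, Y k l = -Y l k) (a b : Fin n) :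
    eta X Y ψ a * eta X Y ψ b + eta X Y ψ b * eta X Y ψ a
      = -(h * (ψ a * eta X Y ψ b) + h * (ψ b * eta X Y ψ a)) := by
  have key : ∀ a b, eta X Y ψ b * eta X Y ψ a
      = -(∑ j, ∑ k, xi X ψ j * xi X ψ k * (Y k b * Y j a))
        - h * (ψ b * eta X Y ψ a) - om X ψ * h * Y b a := by
    intro a b
    have e : ∀ j, eta X Y ψ b * (xi X ψ j * Y j a)
        = -(∑ k, xi X ψ j * xi X ψ k * (Y k b * Y j a)) - h * (ψ b * (xi X ψ j * Y j a))
          - (if j = b then om X ψ * h * Y j a else 0) := by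
      intro j
      rw [← mul_assoc, S.eta_xi, sub_mul, add_mul, ← mul_assoc (ψ b), S.psi_xi, ite_mul, S.h_om,
        eta, Finset.mul_sum, neg_mul, Finset.sum_mul]
      simp only [mul_assoc, neg_mul, mul_neg, zero_mul]
      abel
    conv_lhs => rw [eta.eq_def X Y ψ a]
    conv_rhs => rw [eta.eq_def X Y ψ a]
    simp only [Finset.mul_sum, e, Finset.sum_sub_distrib, Finset.sum_neg_distrib]
    congr 1
    simp
  have anti : ∑ j, ∑ k, xi X ψ j * xi X ψ k * (Y k b * Y j a)
      = -∑ j, ∑ k, xi X ψ j * xi X ψ k * (Y k a * Y j b) := by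
    rw [Finset.sum_comm]
    simp only [← Finset.sum_neg_distrib]
    refine Finset.sum_congr rfl fun j _ => Finset.sum_congr rfl fun k _ => ?_
    rw [S.xi_xi, S.Y_comm, neg_mul]
  rw [key a b, key b a, anti, hY a b, mul_neg]
  abel

theorem col_mul_col (S : CapelliSystem X Y h ψ) (hY : ∀ k l, Y k l = -Y l k) (m : ℕ)
    (a b : Fin n) : col X Y h ψ (m + 1) a * col X Y h ψ m b
      = -(col X Y h ψ (m + 1) b * col X Y h ψ m a) := by
  have e := S.eta_mul_eta_add hY a b
  have e1 : ∀ a b, eta X Y ψ a * (h * ψ b) = -(h * (ψ b * eta X Y ψ a)) := by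
    intro a b
    rw [← mul_assoc, ← S.h_eta, mul_assoc, S.eta_psi, mul_neg]
  have e2 : ∀ a b, h * ψ a * (h * ψ b) = -(h * ψ b * (h * ψ a)) := by
    intro a b
    have : ∀ a b, h * ψ a * (h * ψ b) = h * h * (ψ a * ψ b) := fun a b => by
      rw [mul_assoc, ← mul_assoc (ψ a), ← S.h_psi, mul_assoc, mul_assoc]
    rw [this, this, S.psi_psi a b, mul_neg]
  rw [← add_eq_zero_iff_eq_neg]
  have e' : eta X Y ψ a * eta X Y ψ b = -(h * (ψ a * eta X Y ψ b) + h * (ψ b * eta X Y ψ a))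
      - eta X Y ψ b * eta X Y ψ a := by rw [← e]; abel
  simp only [col, add_mul, mul_add, smul_mul_assoc, mul_smul_comm, e1, mul_assoc h (ψ _) (eta _ _ _ _),
    e', e2 a b, add_smul, one_smul, smul_neg, smul_add]
  abel

theorem exists_sign_colProd_of_perm (S : CapelliSystem X Y h ψ) (hY : ∀ k l, Y k l = -Y l k)
    {U : Type*} [Ring U] {φ : Fin n → U} (hφ : ∀ a b, φ a * φ b = -(φ b * φ a))
    {L L' : List (Fin n)} (hL : L.Perm L') :
    ∃ ε : ℤ, colProd X Y h ψ L = ε • colProd X Y h ψ L' ∧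
      (L.map φ).prod = ε • (L'.map φ).prod := by
  induction hL with
  | nil => exact ⟨1, by simp, by simp⟩
  | cons b hL ih =>
    obtain ⟨ε, h1, h2⟩ := ih
    exact ⟨ε, by simp only [colProd, h1, hL.length_eq, mul_smul_comm],
      by simp only [List.map_cons, List.prod_cons, h2, mul_smul_comm]⟩
  | swap a b L =>
    refine ⟨-1, ?_, ?_⟩
    · simp only [colProd, List.length_cons, ← mul_assoc]
      rw [S.col_mul_col hY]
      simp
    · simp only [List.map_cons, List.prod_cons, ← mul_assoc]
      rw [hφ]
      simp
  | trans _ _ ih1 ih2 =>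
    obtain ⟨ε, h1, h2⟩ := ih1
    obtain ⟨ε', h1', h2'⟩ := ih2
    exact ⟨ε * ε', by rw [h1, h1', mul_smul], by rw [h2, h2', mul_smul]⟩

/-- The additive span of the elements `a ψ_{l₁} ⋯ ψ_{lₘ}` with `a` commuting with every `ψ`. -/
def degreeSpan (ψ : Fin n → T) (m : ℕ) : AddSubgroup T :=
  AddSubgroup.closure {w | ∃ (L : List (Fin n)) (a : T), L.length = m ∧
    (∀ b, a * ψ b = ψ b * a) ∧ w = a * (L.map ψ).prod}

theorem psi_mul_mem_degreeSpan {m : ℕ} {w : T} (b : Fin n) (hw : w ∈ degreeSpan ψ m) :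
    ψ b * w ∈ degreeSpan ψ (m + 1) := by
  induction hw using AddSubgroup.closure_induction with
  | mem w hw =>
    obtain ⟨L, a, hL, ha, rfl⟩ := hw
    exact AddSubgroup.subset_closure
      ⟨b :: L, a, by simp [hL], ha, by rw [← mul_assoc, ← ha, mul_assoc]; simp⟩
  | zero => simp
  | add u v _ _ hu hv => rw [mul_add]; exact add_mem hu hv
  | neg u _ hu => rw [mul_neg]; exact neg_mem hu

theorem xi_mul_mem_degreeSpan (S : CapelliSystem X Y h ψ) {m : ℕ} {w : T} (j : Fin n)
    (hw : w ∈ degreeSpan ψ m) : xi X ψ j * w ∈ degreeSpan ψ (m + 1) := by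
  rw [xi, Finset.sum_mul]
  refine sum_mem fun b _ => ?_
  rw [mul_assoc]
  refine psi_mul_mem_degreeSpan b ?_
  induction hw using AddSubgroup.closure_induction with
  | mem w hw =>
    obtain ⟨L, a, hL, ha, rfl⟩ := hw
    exact AddSubgroup.subset_closure ⟨L, X b j * a, hL,
      fun c => by rw [mul_assoc, ha, ← mul_assoc, S.X_psi, mul_assoc], by rw [mul_assoc]⟩
  | zero => simp
  | add u v _ _ hu hv => rw [mul_add]; exact add_mem hu hv
  | neg u _ hu => rw [mul_neg]; exact neg_mem hu

theorem prod_xi_mul_om_pow_mem_degreeSpan (S : CapelliSystem X Y h ψ) (J : List (Fin n)) (r : ℕ) :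
    (J.map (xi X ψ)).prod * om X ψ ^ r ∈ degreeSpan ψ (J.length + 2 * r) := by
  induction J with
  | nil =>
    simp only [List.map_nil, List.prod_nil, one_mul, List.length_nil, zero_add]
    induction r with
    | zero => exact AddSubgroup.subset_closure ⟨[], 1, by simp, by simp, by simp⟩
    | succ r ih =>
      rw [pow_succ', om, Finset.sum_mul]
      refine sum_mem fun k _ => ?_
      rw [mul_assoc]
      exact S.xi_mul_mem_degreeSpan k (psi_mul_mem_degreeSpan k ih)
  | cons j J ih =>
    rw [List.map_cons, List.prod_cons, mul_assoc, List.length_cons, Nat.add_right_comm]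
    exact S.xi_mul_mem_degreeSpan j ih

theorem prod_xi_mul_om_pow_eq_zero_of_lt (S : CapelliSystem X Y h ψ)
    (htop : ∀ L : List (Fin n), n < L.length → (L.map ψ).prod = 0) (J : List (Fin n)) (r : ℕ)
    (hJ : n < J.length + 2 * r) : (J.map (xi X ψ)).prod * om X ψ ^ r = 0 := by
  have hbot : degreeSpan ψ (J.length + 2 * r) ≤ ⊥ := by
    refine (AddSubgroup.closure_le _).2 ?_
    rintro w ⟨L, a, hL, -, rfl⟩
    simp [htop L (hL ▸ hJ)]
  exact (AddSubgroup.mem_bot).1 (hbot (S.prod_xi_mul_om_pow_mem_degreeSpan J r))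

section Contraction

variable {D : Fin n → T →+ T}

theorem contract_xi_mul
    (hDψ : ∀ j a w, D j (ψ a * w) = (if j = a then w else 0) - ψ a * D j w)
    (hDX : ∀ i j k w, D i (X j k * w) = X j k * D i w) (j k : Fin n) (w : T) :
    D j (xi X ψ k * w) = X j k * w - xi X ψ k * D j w := by
  have key : ∀ a, D j (ψ a * X a k * w) = (if j = a then X a k * w else 0)
      - ψ a * X a k * D j w := by
    intro a
    rw [mul_assoc, hDψ, hDX, mul_assoc]
  simp [xi, Finset.sum_mul, map_sum, key]

theorem contract_om_mul (S : CapelliSystem X Y h ψ) (hX : ∀ k l, X k l = -X l k)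
    (hDψ : ∀ j a w, D j (ψ a * w) = (if j = a then w else 0) - ψ a * D j w)
    (hDX : ∀ i j k w, D i (X j k * w) = X j k * D i w) (j : Fin n) (w : T) :
    D j (om X ψ * w) = om X ψ * D j w - 2 • (xi X ψ j * w) := by
  have key : ∀ k, D j (xi X ψ k * ψ k * w) = -(ψ k * X k j * w)
      - (if j = k then xi X ψ k * w else 0) + xi X ψ k * ψ k * D j w := by
    intro k
    rw [mul_assoc, contract_xi_mul hDψ hDX, hDψ, ← mul_assoc, S.X_psi, hX j k]
    split_ifs <;> simp only [mul_sub, mul_neg, neg_mul, mul_zero, mul_assoc] <;> abel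
  rw [om, Finset.sum_mul, map_sum]
  simp only [key, Finset.sum_add_distrib, Finset.sum_sub_distrib, Finset.sum_neg_distrib,
    ← Finset.sum_mul, Finset.sum_ite_eq, Finset.mem_univ, if_true]
  rw [← xi]
  abel

theorem contract_om_pow (S : CapelliSystem X Y h ψ) (hX : ∀ k l, X k l = -X l k)
    (hDψ : ∀ j a w, D j (ψ a * w) = (if j = a then w else 0) - ψ a * D j w)
    (hDX : ∀ i j k w, D i (X j k * w) = X j k * D i w) (hD1 : ∀ j, D j 1 = 0)
    (j : Fin n) (r : ℕ) :
    D j (om X ψ ^ (r + 1)) = -((2 * (r + 1)) • (xi X ψ j * om X ψ ^ r)) := by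
  induction r with
  | zero => simpa [hD1] using S.contract_om_mul hX hDψ hDX j 1
  | succ r ih =>
    rw [pow_succ', S.contract_om_mul hX hDψ hDX, ih, mul_neg, mul_smul_comm, ← mul_assoc,
      ← S.xi_om, mul_assoc, ← pow_succ', mul_add 2 (r + 1) 1, add_smul]
    abel

theorem prod_xi_mul_contract (S : CapelliSystem X Y h ψ)
    (hDψ : ∀ j a w, D j (ψ a * w) = (if j = a then w else 0) - ψ a * D j w)
    (hDX : ∀ i j k w, D i (X j k * w) = X j k * D i w) (j : Fin n) (w : T) (J K : List (Fin n))
    (hw : ∀ I : List (Fin n), I.length + 1 = K.length + J.length →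
      (I.map (xi X ψ)).prod * w = 0) :
    (K.map (xi X ψ)).prod * D j ((J.map (xi X ψ)).prod * w)
      = (-1) ^ J.length * (((K ++ J).map (xi X ψ)).prod * D j w) := by
  induction J generalizing K with
  | nil => simp
  | cons i J ih =>
    have hcomm : Commute (K.map (xi X ψ)).prod (X j i) := by
      refine Commute.list_prod_left _ _ fun y hy => ?_
      obtain ⟨k, -, rfl⟩ := List.mem_map.1 hy
      exact (S.X_xi j i k).symm
    have h0 := hw (K ++ J) (by simp; omega)
    rw [List.map_append, List.prod_append, mul_assoc] at h0
    have ih' := ih (K ++ [i]) fun I hI => hw I (by simp at hI ⊢; omega)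
    simp only [List.map_append, List.prod_append, List.map_cons, List.map_nil, List.prod_nil, one_mul,
      List.append_assoc, List.singleton_append, List.prod_cons, mul_assoc] at ih' ⊢
    rw [contract_xi_mul hDψ hDX, mul_sub, ← mul_assoc, hcomm.eq, mul_assoc, h0, mul_zero,
      zero_sub, ih', List.length_cons, pow_succ]
    simp

theorem prod_xi_mul_om_pow_eq_zero [Algebra ℂ T] (S : CapelliSystem X Y h ψ) (hn : Odd n)
    (hX : ∀ k l, X k l = -X l k)
    (htop : ∀ L : List (Fin n), n < L.length → (L.map ψ).prod = 0)
    (hDψ : ∀ j a w, D j (ψ a * w) = (if j = a then w else 0) - ψ a * D j w)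
    (hDX : ∀ i j k w, D i (X j k * w) = X j k * D i w) (hD1 : ∀ j, D j 1 = 0)
    (J : List (Fin n)) (r : ℕ) (hJ : J.length + 2 * r = n) :
    (J.map (xi X ψ)).prod * om X ψ ^ r = 0 := by
  induction hk : J.length using Nat.strong_induction_on generalizing J r with
  | _ k ih =>
    obtain rfl | ⟨J, j, rfl⟩ := J.eq_nil_or_concat
    · simp only [List.length_nil] at hJ
      obtain ⟨c, hc⟩ := hn
      omega
    · simp only [List.concat_eq_append, List.length_append, List.length_singleton] at hJ hk
      have e := S.prod_xi_mul_contract hDψ hDX j (om X ψ ^ (r + 1)) J [] fun I hI =>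
        ih I.length (by simp at hI; omega) I (r + 1) (by simp at hI; omega) rfl
      rw [S.prod_xi_mul_om_pow_eq_zero_of_lt htop J (r + 1) (by omega), map_zero, mul_zero,
        S.contract_om_pow hX hDψ hDX hD1, List.nil_append] at e
      have e2 : (2 * (r + 1)) • ((J.map (xi X ψ)).prod * (xi X ψ j * om X ψ ^ r)) = 0 := by
        rw [← mul_smul_comm]
        rcases neg_one_pow_eq_or T J.length with h1 | h1 <;> rw [h1] at e <;>
          simpa only [one_mul, neg_mul, mul_neg, neg_neg, zero_eq_neg, eq_comm] using e
      rw [← Nat.cast_smul_eq_nsmul ℂ] at e2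
      have e3 := (smul_eq_zero_iff_right (M := T) (R := ℂ)
        (by exact_mod_cast (by omega : 2 * (r + 1) ≠ 0))).1 e2
      simpa [mul_assoc] using e3

theorem colProd_eq_zero [Algebra ℂ T] (S : CapelliSystem X Y h ψ) (hn : Odd n)
    (hX : ∀ k l, X k l = -X l k)
    (htop : ∀ L : List (Fin n), n < L.length → (L.map ψ).prod = 0)
    (hDψ : ∀ j a w, D j (ψ a * w) = (if j = a then w else 0) - ψ a * D j w)
    (hDX : ∀ i j k w, D i (X j k * w) = X j k * D i w) (hD1 : ∀ j, D j 1 = 0)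
    (L : List (Fin n)) (hL : L.length = n) : colProd X Y h ψ L = 0 := by
  have hbot : normalSpan X ψ L.length ≤ ⊥ := by
    refine (AddSubgroup.closure_le _).2 ?_
    rintro w ⟨J, r, t, hJ, rfl⟩
    simp [S.prod_xi_mul_om_pow_eq_zero hn hX htop hDψ hDX hD1 J r (hJ.trans hL)]
  exact (AddSubgroup.mem_bot).1 (hbot (S.colProd_mem_normalSpan L))

end Contraction

theorem colProd_map_finRange (X Y : Fin n → Fin n → T) (h : T) (ψ : Fin n → T) {m : ℕ}
    (f : Fin m → Fin n) : colProd X Y h ψ ((List.finRange m).map f)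
      = ((List.finRange m).map fun i : Fin m => col X Y h ψ (m - 1 - (i : ℕ)) (f i)).prod := by
  induction m with
  | zero => simp [colProd]
  | succ m ih =>
    rw [List.finRange_succ, List.map_cons, List.map_cons, List.prod_cons, colProd, List.map_map,
      List.map_map, ih]
    simp only [List.length_map, List.length_finRange, Function.comp_def, Fin.val_succ, Fin.val_zero]
    congr 2
    refine List.map_congr_left fun i _ => ?_
    congr 1
    omega

end CapelliSystem

open scoped TensorProduct

/-- The standard generators of the exterior algebra on `Fin n → ℂ`. -/
noncomputable def gen {n : ℕ} (a : Fin n) : ExteriorAlgebra ℂ (Fin n → ℂ) :=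
  ExteriorAlgebra.ι ℂ (Pi.single a 1)

theorem gen_mul_gen {n : ℕ} (a b : Fin n) : gen a * gen b = -(gen b * gen a) := by
  rw [← add_eq_zero_iff_eq_neg]
  exact ExteriorAlgebra.ι_add_mul_swap _ _

theorem prod_map_gen_eq_ιMulti {n m : ℕ} (f : Fin m → Fin n) :
    ((List.finRange m).map fun i => gen (f i)).prod
      = ExteriorAlgebra.ιMulti ℂ m fun i => (Pi.single (f i) 1 : Fin n → ℂ) := by
  rw [ExteriorAlgebra.ιMulti_apply, List.ofFn_eq_map]
  rfl

theorem prod_map_gen_eq_zero {n : ℕ} (L : List (Fin n)) (hL : n < L.length) :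
    (L.map gen).prod = 0 := by
  have hinj : ¬ Function.Injective L.get := fun hi => by
    have := Fintype.card_le_of_injective _ hi
    simp at this
    omega
  have e : L.map gen = (List.finRange L.length).map fun i => gen (L.get i) := by
    conv_lhs => rw [← List.map_get_finRange L]
    rw [List.map_map]
    rfl
  rw [e, prod_map_gen_eq_ιMulti]
  refine AlternatingMap.map_eq_zero_of_not_injective _ _ fun hi => hinj fun i j hij => hi ?_
  simp only [hij]

section TopCoeff

variable {A : Type*} [Ring A] [Algebra ℂ A] {n : ℕ}

/-- The coefficient of the top form `gen 0 * ⋯ * gen (n - 1)`. -/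
noncomputable def topCoeff (A : Type*) [Ring A] [Algebra ℂ A] (n : ℕ) :
    A ⊗[ℂ] ExteriorAlgebra ℂ (Fin n → ℂ) →ₗ[ℂ] A :=
  (TensorProduct.rid ℂ A).toLinearMap ∘ₗ LinearMap.lTensor A
    (ExteriorAlgebra.liftAlternating (R := ℂ)
      (Pi.single n (Matrix.detRowAlternating : (Fin n → ℂ) [⋀^Fin n]→ₗ[ℂ] ℂ)))

theorem topCoeff_tmul (a : A) (f : Fin n → Fin n) :
    topCoeff A n (a ⊗ₜ ((List.finRange n).map fun i => gen (f i)).prod)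
      = Matrix.det (fun i => (Pi.single (f i) 1 : Fin n → ℂ)) • a := by
  rw [prod_map_gen_eq_ιMulti]
  simp [topCoeff, Matrix.detRowAlternating]
  rfl

theorem det_single_perm (τ : Equiv.Perm (Fin n)) :
    Matrix.det (fun i => (Pi.single (τ i) 1 : Fin n → ℂ)) = ((Equiv.Perm.sign τ : ℤ) : ℂ) := by
  have := Matrix.det_permute τ (1 : Matrix (Fin n) (Fin n) ℂ)
  rw [Matrix.det_one, mul_one] at this
  rw [← this]
  congr 1
  ext i j
  simp [Matrix.one_apply, Pi.single_apply, eq_comm]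

theorem prod_map_tmul {B C : Type*} [Ring B] [Algebra ℂ B] [Ring C] [Algebra ℂ C] {ι : Type*}
    (f : ι → B) (g : ι → C) (L : List ι) :
    (L.map fun i => f i ⊗ₜ[ℂ] g i).prod = (L.map f).prod ⊗ₜ (L.map g).prod := by
  induction L with
  | nil => rfl
  | cons i L ih => simp [ih]

theorem topCoeff_prod (M : Fin n → Fin n → A) :
    topCoeff A n ((List.finRange n).map fun i => ∑ b, M i b ⊗ₜ gen b).prod
      = ∑ τ : Equiv.Perm (Fin n), (Equiv.Perm.sign τ : ℤ) •
          ((List.finRange n).map fun i => M i (τ i)).prod := by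
  rw [← List.ofFn_eq_map, ← MultilinearMap.mkPiAlgebraFin_apply (R := ℂ), MultilinearMap.map_sum,
    map_sum]
  simp only [MultilinearMap.mkPiAlgebraFin_apply, List.ofFn_eq_map, prod_map_tmul, topCoeff_tmul]
  symm
  refine Finset.sum_of_injOn (fun τ : Equiv.Perm (Fin n) => (τ : Fin n → Fin n))
    (fun _ _ _ _ hab => Equiv.coe_fn_injective hab) (by simp [Set.MapsTo]) (fun f _ hf => ?_)
    (fun τ _ => ?_)
  · have hinj : ¬ Function.Injective f := fun hi => hf
      ⟨Equiv.ofBijective f (Finite.injective_iff_bijective.1 hi), by simp, rfl⟩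
    have : Matrix.detRowAlternating (fun i => (Pi.single (f i) 1 : Fin n → ℂ)) = 0 := by
      refine AlternatingMap.map_eq_zero_of_not_injective _ _ fun hi => hinj fun i j hij => hi ?_
      simp only [hij]
    change Matrix.detRowAlternating (fun i => (Pi.single (f i) 1 : Fin n → ℂ)) • _ = _
    rw [this, zero_smul]
  · rw [det_single_perm, Int.cast_smul_eq_zsmul]

/-- Contraction against the `j`-th coordinate on the exterior factor. -/
noncomputable def contract (A : Type*) [Ring A] [Algebra ℂ A] {n : ℕ} (j : Fin n) :
    A ⊗[ℂ] ExteriorAlgebra ℂ (Fin n → ℂ) →ₗ[ℂ] A ⊗[ℂ] ExteriorAlgebra ℂ (Fin n → ℂ) :=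
  LinearMap.lTensor A (CliffordAlgebra.contractLeft (Q := 0) (LinearMap.proj j))

theorem contract_gen_mul (j a : Fin n) (w : A ⊗[ℂ] ExteriorAlgebra ℂ (Fin n → ℂ)) :
    contract A j ((1 ⊗ₜ gen a) * w)
      = (if j = a then w else 0) - (1 ⊗ₜ gen a) * contract A j w := by
  induction w using TensorProduct.induction_on with
  | zero => simp
  | add u v hu hv =>
    rw [mul_add, map_add, hu, hv, map_add, mul_add]
    split_ifs <;> abel
  | tmul c x =>
    have e := CliffordAlgebra.contractLeft_ι_mul (Q := (0 : QuadraticForm ℂ (Fin n → ℂ)))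
      (d := LinearMap.proj j) (Pi.single a 1) x
    rw [Algebra.TensorProduct.tmul_mul_tmul, one_mul]
    simp only [contract, LinearMap.lTensor_tmul, Algebra.TensorProduct.tmul_mul_tmul, one_mul]
    rw [gen, ExteriorAlgebra.ι, e, TensorProduct.tmul_sub]
    congr 1
    by_cases hja : j = a <;> simp [hja]

theorem contract_tmul_one_mul (j : Fin n) (c : A) (w : A ⊗[ℂ] ExteriorAlgebra ℂ (Fin n → ℂ)) :
    contract A j ((c ⊗ₜ 1) * w) = (c ⊗ₜ 1) * contract A j w := by
  induction w using TensorProduct.induction_on with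
  | zero => simp
  | add u v hu hv => rw [mul_add, map_add, hu, hv, map_add, mul_add]
  | tmul d x => simp [contract]

theorem contract_one (j : Fin n) : contract A j 1 = 0 := by
  rw [Algebra.TensorProduct.one_def, contract, LinearMap.lTensor_tmul,
    CliffordAlgebra.contractLeft_one, TensorProduct.tmul_zero]

end TopCoeff

namespace CapelliPair

variable {A : Type*} [Ring A] {n : ℕ} {X Y : Fin n → Fin n → A} {h : A}

open MulOpposite in
theorem op (P : CapelliPair X Y h) :
    CapelliPair (fun i j => op (Y j i)) (fun i j => op (X j i)) (op h) where
  X_comm i j k l := by simp only [← op_mul, P.Y_comm]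
  Y_comm i j k l := by simp only [← op_mul, P.X_comm]
  h_X i j := by simp only [← op_mul, P.h_Y]
  h_Y i j := by simp only [← op_mul, P.h_X]
  X_Y i j k l := by
    simp only [← op_mul, ← op_sub, P.X_Y]
    have h1 : (k = j ∧ l = i) ↔ (j = k ∧ i = l) := by rw [eq_comm, eq_comm (a := l)]
    have h2 : (l = j ∧ k = i) ↔ (i = k ∧ j = l) := by rw [and_comm, eq_comm, eq_comm (a := l)]
    simp only [h1, h2, op_neg, op_sub]
    split_ifs <;> rfl

/-- The entries of `XY` shifted by `m h` on the diagonal. -/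
def entry (X Y : Fin n → Fin n → A) (h : A) (m : ℕ) (a b : Fin n) : A :=
  ∑ j, X a j * Y j b + if a = b then m • h else 0

variable [Algebra ℂ A]

theorem system (P : CapelliPair X Y h) : CapelliSystem
    (T := A ⊗[ℂ] ExteriorAlgebra ℂ (Fin n → ℂ)) (fun i j => X i j ⊗ₜ 1) (fun i j => Y i j ⊗ₜ 1)
    (h ⊗ₜ 1) (fun a => 1 ⊗ₜ gen a) where
  X_comm i j k l := by simp [P.X_comm i j k l]
  Y_comm i j k l := by simp [P.Y_comm i j k l]
  h_X i j := by simp [P.h_X]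
  h_Y i j := by simp [P.h_Y]
  X_Y i j k l := by
    rw [Algebra.TensorProduct.tmul_mul_tmul, Algebra.TensorProduct.tmul_mul_tmul, one_mul,
      ← TensorProduct.sub_tmul, P.X_Y, TensorProduct.neg_tmul, TensorProduct.sub_tmul,
      TensorProduct.ite_tmul, TensorProduct.ite_tmul]
  X_psi i j a := by simp
  Y_psi i j a := by simp
  h_psi a := by simp
  psi_psi a b := by simp [gen_mul_gen a b, TensorProduct.tmul_neg]

open CapelliSystem

/-- The columns of `XY + m h` in the tensor product with the exterior algebra. -/
noncomputable def extCol (X Y : Fin n → Fin n → A) (h : A) (m : ℕ) (b : Fin n) :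
    A ⊗[ℂ] ExteriorAlgebra ℂ (Fin n → ℂ) :=
  CapelliSystem.col (fun i j => X i j ⊗ₜ 1) (fun i j => Y i j ⊗ₜ 1) (h ⊗ₜ 1) (fun a => 1 ⊗ₜ gen a) m b

theorem extCol_eq_sum (m : ℕ) (b : Fin n) :
    extCol X Y h m b = ∑ a, entry X Y h m a b ⊗ₜ gen a := by
  simp only [extCol, CapelliSystem.col, eta, xi, entry, Finset.sum_mul, Algebra.TensorProduct.tmul_mul_tmul,
    one_mul, mul_one, TensorProduct.add_tmul, TensorProduct.sum_tmul, TensorProduct.ite_tmul,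
    Finset.sum_add_distrib]
  rw [Finset.sum_comm]
  simp [TensorProduct.smul_tmul', -nsmul_eq_mul]

theorem topCoeff_prod_extCol (s : Fin n → ℕ) (f : Fin n → Fin n) :
    topCoeff A n ((List.finRange n).map fun i => extCol X Y h (s i) (f i)).prod
      = ∑ σ : Equiv.Perm (Fin n), (Equiv.Perm.sign σ : ℤ) •
          ((List.finRange n).map fun i => entry X Y h (s i) (σ i) (f i)).prod := by
  simp only [extCol_eq_sum]
  exact topCoeff_prod fun i a => entry X Y h (s i) a (f i)

/-- If `X` is antisymmetric of odd size then the Capelli column determinant of any family of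
columns of `XY` vanishes. -/
theorem sum_sign_prod_entry_column_eq_zero (P : CapelliPair X Y h) (hn : Odd n)
    (hX : ∀ k l, X k l = -X l k) (f : Fin n → Fin n) :
    ∑ σ : Equiv.Perm (Fin n), (Equiv.Perm.sign σ : ℤ) • ((List.finRange n).map
      fun i : Fin n => entry X Y h (n - 1 - (i : ℕ)) (σ i) (f i)).prod = 0 := by
  have e := P.system.colProd_eq_zero (D := fun j => (contract A j).toAddMonoidHom) hn
    (fun k l => by rw [hX k l, TensorProduct.neg_tmul])
    (fun L hL => by
      have : (L.map fun a => (1 : A) ⊗ₜ[ℂ] gen a).prod = _ := prod_map_tmul (fun _ => 1) gen L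
      rw [this, prod_map_gen_eq_zero L hL, TensorProduct.tmul_zero])
    (fun j a w => contract_gen_mul j a w) (fun i j k w => contract_tmul_one_mul i (X j k) w)
    (fun j => contract_one j) ((List.finRange n).map f) (by simp)
  rw [colProd_map_finRange] at e
  have := topCoeff_prod_extCol (X := X) (Y := Y) (h := h) (fun i : Fin n => n - 1 - (i : ℕ)) f
  rw [← this]
  exact (congrArg (topCoeff A n) e).trans (map_zero _)

theorem sum_sign_prod_entry_row_eq_zero (P : CapelliPair X Y h) (hn : Odd n)
    (hY : ∀ k l, Y k l = -Y l k) (f : Fin n → Fin n) :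
    ∑ σ : Equiv.Perm (Fin n), (Equiv.Perm.sign σ : ℤ) • ((List.finRange n).map
      fun i : Fin n => entry X Y h (i : ℕ) (f i) (σ i)).prod = 0 := by
  have e := P.op.sum_sign_prod_entry_column_eq_zero hn
    (fun k l => by rw [hY l k, MulOpposite.op_neg]) (f ∘ Fin.rev)
  have hentry : ∀ m a b, entry (fun i j => MulOpposite.op (Y j i))
      (fun i j => MulOpposite.op (X j i)) (MulOpposite.op h) m a b
      = MulOpposite.op (entry X Y h m b a) := by
    intro m a b
    simp only [entry, MulOpposite.op_add, Finset.op_sum, MulOpposite.op_mul, eq_comm (a := a)]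
    split_ifs <;> simp [-nsmul_eq_mul]
  have hprod : ∀ σ : Equiv.Perm (Fin n), ((List.finRange n).map fun i : Fin n =>
      MulOpposite.op (entry X Y h (n - 1 - (i : ℕ)) (f (Fin.rev i)) (σ i))).prod
      = MulOpposite.op ((List.finRange n).map fun i : Fin n =>
        entry X Y h (i : ℕ) (f i)
          ((σ * (Fin.revPerm : Equiv.Perm (Fin n)) : Equiv.Perm (Fin n)) i)).prod := by
    intro σ
    rw [MulOpposite.op_list_prod, ← List.map_reverse, ← List.map_reverse, List.finRange_reverse,
      List.map_map, List.map_map]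
    congr 1
    refine List.map_congr_left fun i _ => ?_
    have : n - 1 - (i : ℕ) = (Fin.rev i : ℕ) := by rw [Fin.val_rev]; omega
    simp [this]
  simp only [hentry, hprod, Function.comp_apply] at e
  have e1 := congrArg MulOpposite.unop e
  simp only [Finset.unop_sum, MulOpposite.unop_smul, MulOpposite.unop_op, MulOpposite.unop_zero]
    at e1
  rw [← Equiv.sum_comp (Equiv.mulRight (Fin.revPerm : Equiv.Perm (Fin n)))]
  simp only [Equiv.coe_mulRight, map_mul, Units.val_mul]
  simp only [mul_comm _ (((Equiv.Perm.sign Fin.revPerm : ℤˣ)) : ℤ), mul_smul, ← Finset.smul_sum]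
  rw [e1, smul_zero]

theorem sum_sign_prod_extCol_comp_perm (P : CapelliPair X Y h) (s : Fin n → ℕ)
    (π : Equiv.Perm (Fin n)) :
    ∑ τ : Equiv.Perm (Fin n), (Equiv.Perm.sign τ : ℤ) •
        ((List.finRange n).map fun i => extCol X Y h (s (π i)) (τ i)).prod
      = ∑ τ : Equiv.Perm (Fin n), (Equiv.Perm.sign τ : ℤ) •
        ((List.finRange n).map fun i => extCol X Y h (s i) (τ i)).prod := by
  rw [← topCoeff_prod fun i b => extCol X Y h (s (π i)) b,
    ← topCoeff_prod fun i b => extCol X Y h (s i) b]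
  congr 1
  set F : ℕ → (A ⊗[ℂ] ExteriorAlgebra ℂ (Fin n → ℂ)) ⊗[ℂ] ExteriorAlgebra ℂ (Fin n → ℂ) :=
    fun m => ∑ b, extCol X Y h m b ⊗ₜ gen b with hF
  have hdecomp : ∀ m, F m = (∑ b, extCol X Y h 0 b ⊗ₜ gen b)
      + m • ∑ b, ((h ⊗ₜ 1) * (1 ⊗ₜ gen b)) ⊗ₜ gen b := by
    intro m
    simp only [hF, extCol, CapelliSystem.col, zero_smul, add_zero, TensorProduct.add_tmul,
      Finset.sum_add_distrib]
    rw [← Finset.sum_nsmul]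
    exact congrArg _ (Finset.sum_congr rfl fun b _ =>
      map_nsmul ((TensorProduct.mk ℂ _ _).flip (gen b)) m _)
  have hcomm0 : Commute (∑ b, extCol X Y h 0 b ⊗ₜ[ℂ] gen b)
      (∑ b, ((h ⊗ₜ 1) * (1 ⊗ₜ gen b)) ⊗ₜ[ℂ] gen b) := by
    refine Commute.sum_left _ _ _ fun b _ => Commute.sum_right _ _ _ fun c _ => ?_
    have S := P.system
    have e : extCol X Y h 0 b * ((h ⊗ₜ 1) * (1 ⊗ₜ gen c))
        = -(((h ⊗ₜ 1) * (1 ⊗ₜ gen c)) * extCol X Y h 0 b) := by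
      simp only [extCol, CapelliSystem.col, zero_smul, add_zero]
      rw [← mul_assoc, ← S.h_eta, mul_assoc, S.eta_psi, mul_neg, mul_assoc]
    generalize (h ⊗ₜ[ℂ] (1 : ExteriorAlgebra ℂ (Fin n → ℂ))) * (1 ⊗ₜ gen c) = u at e ⊢
    rw [commute_iff_eq, Algebra.TensorProduct.tmul_mul_tmul, Algebra.TensorProduct.tmul_mul_tmul,
      e, gen_mul_gen b c, TensorProduct.neg_tmul, TensorProduct.tmul_neg, neg_neg]
  have hcomm : ∀ m m', Commute (F m) (F m') := by
    intro m m'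
    rw [hdecomp, hdecomp]
    exact ((Commute.refl _).add_right (hcomm0.smul_right _)).add_left
      ((hcomm0.symm.add_right ((Commute.refl _).smul_right _)).smul_left _)
  have hperm : ((List.finRange n).map fun i => F (s (π i))).Perm
      ((List.finRange n).map fun i => F (s i)) := by
    have := (π.map_finRange_perm).map fun i => F (s i)
    rwa [List.map_map] at this
  refine hperm.prod_eq' (List.pairwise_of_forall_mem_list fun x hx y hy => ?_)
  obtain ⟨i, -, rfl⟩ := List.mem_map.1 hx
  obtain ⟨j, -, rfl⟩ := List.mem_map.1 hy
  exact hcomm _ _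

theorem prod_extCol_perm (P : CapelliPair X Y h) (hY : ∀ k l, Y k l = -Y l k)
    (τ : Equiv.Perm (Fin n)) :
    ((List.finRange n).map fun i : Fin n => extCol X Y h (n - 1 - (i : ℕ)) (τ i)).prod
      = (Equiv.Perm.sign τ : ℤ) •
        ((List.finRange n).map fun i : Fin n => extCol X Y h (n - 1 - (i : ℕ)) i).prod := by
  obtain ⟨ε, h1, h2⟩ := P.system.exists_sign_colProd_of_perm
    (fun k l => by rw [hY k l, TensorProduct.neg_tmul]) gen_mul_gen τ.map_finRange_perm
  have h3 := congrArg (fun x => topCoeff ℂ n (1 ⊗ₜ x)) h2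
  have hdet := det_single_perm (1 : Equiv.Perm (Fin n))
  have ht := topCoeff_tmul (n := n) (1 : ℂ) id
  simp only [Equiv.Perm.coe_one, id_eq, Equiv.Perm.sign_one, Units.val_one, Int.cast_one] at hdet ht
  simp only [List.map_map, Function.comp_def, TensorProduct.tmul_smul, map_zsmul] at h3
  rw [topCoeff_tmul, det_single_perm, ht, hdet] at h3
  simp only [smul_eq_mul, mul_one, zsmul_eq_mul] at h3
  rw [Int.cast_inj.1 h3]
  conv_rhs at h1 => rw [← List.map_id (List.finRange n)]
  rw [colProd_map_finRange, colProd_map_finRange] at h1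
  exact h1

theorem sum_sign_prod_entry_eq_zero (P : CapelliPair X Y h) (hn : Odd n)
    (hY : ∀ k l, Y k l = -Y l k) :
    ∑ σ : Equiv.Perm (Fin n), (Equiv.Perm.sign σ : ℤ) • ((List.finRange n).map
      fun i : Fin n => entry X Y h (n - 1 - (i : ℕ)) (σ i) i).prod = 0 := by
  have e := P.sum_sign_prod_extCol_comp_perm (fun i => (i : ℕ)) Fin.revPerm
  have hrev : ∀ i : Fin n, ((Fin.revPerm i : Fin n) : ℕ) = n - 1 - (i : ℕ) := by
    intro i
    rw [Fin.revPerm_apply, Fin.val_rev]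
    omega
  simp only [hrev, P.prod_extCol_perm hY, smul_smul, ← Units.val_mul, Int.units_mul_self,
    Units.val_one, one_smul, Finset.sum_const] at e
  have e1 := congrArg (topCoeff A n) e
  rw [map_nsmul, topCoeff_prod_extCol (fun i : Fin n => n - 1 - (i : ℕ)) (fun i => i), map_sum]
    at e1
  have hz : ∑ τ : Equiv.Perm (Fin n), topCoeff A n ((Equiv.Perm.sign τ : ℤ) •
      ((List.finRange n).map fun i : Fin n => extCol X Y h (i : ℕ) (τ i)).prod) = 0 := by
    simp only [map_zsmul, fun τ : Equiv.Perm (Fin n) =>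
      topCoeff_prod_extCol (X := X) (Y := Y) (h := h) (fun i : Fin n => (i : ℕ)) τ, Finset.smul_sum]
    rw [Finset.sum_comm]
    refine Finset.sum_eq_zero fun σ _ => ?_
    simp only [smul_comm _ (Equiv.Perm.sign σ : ℤ), ← Finset.smul_sum]
    rw [P.sum_sign_prod_entry_row_eq_zero hn hY σ, smul_zero]
  rw [hz, ← Nat.cast_smul_eq_nsmul ℂ] at e1
  exact (smul_eq_zero_iff_right (M := A) (R := ℂ)
    (by exact_mod_cast (Finset.card_ne_zero_of_mem (Finset.mem_univ 1)))).1 e1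

end CapelliPair

theorem cdet_eq_zero_of_antisymm {A : Type*} [Ring A] [Algebra ℂ A] {n : ℕ} (hn : Odd n)
    (X : Matrix (Fin n) (Fin n) A) (hcomm : ∀ i j k l, Commute (X i j) (X k l))
    (hX : ∀ k l, X k l = -X l k) : cdet X = 0 := by
  have P : CapelliPair X (fun i j => if i = j then (1 : A) else 0) (0 : A) := by
    refine ⟨fun i j k l => hcomm i j k l, ?_, ?_, ?_, ?_⟩
    · intro i j k l; simp only [mul_ite, mul_one, mul_zero]
      split_ifs <;> rfl
    · simp
    · simp
    · intro i j k l; split_ifs <;> simp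
  have e := P.sum_sign_prod_entry_column_eq_zero hn hX id
  simpa [CapelliPair.entry, cdet] using e

theorem huks_odd
    {A : Type*} [Ring A] [Algebra ℂ A] (n : ℕ) (hn : Odd n) (hpos : 0 < n)
    (X Y : Matrix (Fin n) (Fin n) A)
    (hXcomm : ∀ i j k l, Commute (X i j) (X k l))
    (hYcomm : ∀ i j k l, Commute (Y i j) (Y k l))
    (hanti : (∀ k l, X k l = - X l k) ∨ (∀ k l, Y k l = - Y l k))
    (h : A)
    (hhX : ∀ i j, Commute h (X i j)) (hhY : ∀ i j, Commute h (Y i j))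
    (hXY : ∀ i j k l, X i j * Y k l - Y k l * X i j
        = -((if j = k ∧ i = l then h else 0) - (if i = k ∧ j = l then h else 0))) :
    cdet (Matrix.of fun a b : Fin n =>
        (X * Y) a b + if a = b then (n - 1 - (b : ℕ)) • h else 0)
      = cdet X * cdet Y ∧ cdet X * cdet Y = 0 := by
  have P : CapelliPair X Y h := ⟨hXcomm, hYcomm, hhX, hhY, hXY⟩
  have h0 : cdet X * cdet Y = 0 := by
    rcases hanti with hX | hY
    · rw [cdet_eq_zero_of_antisymm hn X hXcomm hX, zero_mul]
    · rw [cdet_eq_zero_of_antisymm hn Y hYcomm hY, mul_zero]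
  refine ⟨?_, h0⟩
  rw [h0]
  rcases hanti with hX | hY
  · exact P.sum_sign_prod_entry_column_eq_zero hn hX id
  · exact P.sum_sign_prod_entry_eq_zero hn hY

end Stmt9
end
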